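/- Let Σ be an open convex cone in ℝⁿ (n ≥ 1), and let w be a continuous function on the closure of Σ that is positive and C^{1,γ} in Σ for some γ ∈ (0,1), homogeneous of degree α ≥ 0 (i.e., w(tx) = t^α w(x) for all t > 0 and x ∈ Σ), and such that w^{1/α} is concave on Σ in case α > 0. Set D = n + α. Then for every bounded Lipschitz domain Ω ⊂ Σ, one has P_Σ(Ω) / m(Ω)^{(D-1)/D} ≥ P_Σ(Σ ∩ B₁) / m(Σ ∩ B₁)^{(D-1)/D}, where B₁ is the open Euclidean unit ball of ℝⁿ centered at the origin. -/

import Mathlib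

open MeasureTheory Metric Set
open scoped RealInnerProductSpace NNReal ENNReal

noncomputable section

/-- A bounded Lipschitz domain in `ℝⁿ`: a bounded, connected, open set whose boundary is
locally the graph of a Lipschitz function (the set lying locally on one side of the graph). -/
def IsLipschitzDomain {n : ℕ} (Ω : Set (EuclideanSpace ℝ (Fin n))) : Prop :=
  IsOpen Ω ∧ IsConnected Ω ∧ Bornology.IsBounded Ω ∧
  ∀ x ∈ frontier Ω, ∃ r > (0:ℝ), ∃ v : EuclideanSpace ℝ (Fin n), ‖v‖ = 1 ∧
    ∃ (K : ℝ≥0) (φ : EuclideanSpace ℝ (Fin n) → ℝ), LipschitzWith K φ ∧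
      ∀ y ∈ ball x r, (y ∈ Ω ↔ φ (y - ⟪y, v⟫ • v) < ⟪y, v⟫)

open scoped Pointwise in
theorem volume_add_le_volume_add_real {A B : Set ℝ} (hA : MeasurableSet A) (hB : MeasurableSet B)
    (hA0 : A.Nonempty) (hB0 : B.Nonempty) : volume A + volume B ≤ volume (A + B) := by
  obtain ⟨a₀, ha₀⟩ := hA0
  obtain ⟨b₀, hb₀⟩ := hB0
  have key : ∀ K ⊆ A, IsCompact K → ∀ L ⊆ B, IsCompact L → K.Nonempty → L.Nonempty →
      volume K + volume L ≤ volume (A + B) := by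
    intro K hKA hK L hLB hL hK0 hL0
    obtain ⟨x, hxK, hx⟩ := hK.exists_isGreatest hK0
    obtain ⟨y, hyL, hy⟩ := hL.exists_isLeast hL0
    have h1 : volume K = volume (y +ᵥ K) := by rw [measure_vadd]
    have h2 : volume L = volume (x +ᵥ L) := by rw [measure_vadd]
    have hd : AEDisjoint volume (y +ᵥ K) (x +ᵥ L) := by
      refine measure_mono_null (t := {x + y}) ?_ (by simp)
      rintro z ⟨⟨k, hk, rfl⟩, ⟨l, hl, h⟩⟩
      have := hx hk
      have := hy hl
      simp only [vadd_eq_add, mem_singleton_iff] at h ⊢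
      linarith
    rw [h1, h2, ← measure_union₀ (hL.measurableSet.const_vadd x).nullMeasurableSet hd]
    refine measure_mono (union_subset ?_ ?_)
    · rintro _ ⟨k, hk, rfl⟩
      exact ⟨k, hKA hk, y, hLB hyL, add_comm _ _⟩
    · rintro _ ⟨l, hl, rfl⟩
      exact ⟨x, hKA hxK, l, hLB hl, rfl⟩
  rw [hA.measure_eq_iSup_isCompact, hB.measure_eq_iSup_isCompact]
  simp_rw [iSup_and']
  refine ENNReal.biSup_add_biSup_le' ⟨∅, empty_subset _, isCompact_empty⟩
    ⟨∅, empty_subset _, isCompact_empty⟩ ?_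
  rintro K ⟨hKA, hK⟩ L ⟨hLB, hL⟩
  calc volume K + volume L ≤ volume (insert a₀ K) + volume (insert b₀ L) := by
        gcongr <;> exact subset_insert _ _
    _ ≤ _ := key _ (insert_subset ha₀ hKA) (hK.insert _) _ (insert_subset hb₀ hLB) (hL.insert _)
        (insert_nonempty _ _) (insert_nonempty _ _)

theorem volume_convexCombo_le {A B C : Set ℝ} (hA : MeasurableSet A) (hB : MeasurableSet B)
    (hA0 : A.Nonempty) (hB0 : B.Nonempty) {a b : ℝ} (ha : 0 < a) (hb : 0 < b)
    (hC : ∀ x ∈ A, ∀ y ∈ B, a * x + b * y ∈ C) :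
    ENNReal.ofReal a * volume A + ENNReal.ofReal b * volume B ≤ volume C := by
  open scoped Pointwise in
  have h1 : volume (a • A) = ENNReal.ofReal a * volume A := by
    simp [Measure.addHaar_smul, abs_of_pos ha]
  have h2 : volume (b • B) = ENNReal.ofReal b * volume B := by
    simp [Measure.addHaar_smul, abs_of_pos hb]
  rw [← h1, ← h2]
  refine (volume_add_le_volume_add_real (hA.const_smul₀ a) (hB.const_smul₀ b)
    hA0.smul_set hB0.smul_set).trans (measure_mono ?_)
  rintro _ ⟨_, ⟨x, hx, rfl⟩, _, ⟨y, hy, rfl⟩, rfl⟩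
  exact hC x hx y hy

theorem ENNReal.geom_mean_le_arith_mean2 {a b : ℝ} (ha : 0 < a) (hb : 0 < b) (hab : a + b = 1)
    (x y : ℝ≥0∞) :
    x ^ a * y ^ b ≤ ENNReal.ofReal a * x + ENNReal.ofReal b * y := by
  rcases eq_or_ne x ∞ with rfl | hx
  · simp [ENNReal.mul_top, ha]
  rcases eq_or_ne y ∞ with rfl | hy
  · simp [ENNReal.mul_top, hb]
  lift x to ℝ≥0 using hx
  lift y to ℝ≥0 using hy
  rw [← ENNReal.coe_rpow_of_nonneg _ ha.le, ← ENNReal.coe_rpow_of_nonneg _ hb.le]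
  have := NNReal.geom_mean_le_arith_mean2_weighted a.toNNReal b.toNNReal x y
    (by rw [← Real.toNNReal_add ha.le hb.le, hab, Real.toNNReal_one])
  rw [Real.coe_toNNReal _ ha.le, Real.coe_toNNReal _ hb.le] at this
  unfold ENNReal.ofReal
  exact_mod_cast this

theorem lintegral_eq_lintegral_meas_lt_of_le_one {f : ℝ → ℝ≥0∞} (hf : Measurable f)
    (hf1 : ∀ x, f x ≤ 1) :
    ∫⁻ x, f x = ∫⁻ t in Ioi (0 : ℝ), volume {x | ENNReal.ofReal t < f x} := by
  have h := lintegral_eq_lintegral_meas_lt (μ := volume) (f := fun x => (f x).toReal)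
    (ae_of_all _ fun x => ENNReal.toReal_nonneg) hf.ennreal_toReal.aemeasurable
  have hfin : ∀ x, f x ≠ ∞ := fun x => ((hf1 x).trans_lt ENNReal.one_lt_top).ne
  simp_rw [ENNReal.ofReal_toReal (hfin _)] at h
  rw [h]
  refine setLIntegral_congr_fun measurableSet_Ioi fun t ht => ?_
  simp_rw [ENNReal.ofReal_lt_iff_lt_toReal (le_of_lt ht) (hfin _)]

theorem add_lintegral_le_of_iSup_eq_one {f g h : ℝ → ℝ≥0∞} (hf : Measurable f) (hg : Measurable g)
    (hh : Measurable h) {a b : ℝ} (ha : 0 < a) (hb : 0 < b) (hab : a + b = 1)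
    (hf1 : ⨆ x, f x = 1) (hg1 : ⨆ x, g x = 1)
    (H : ∀ x y, f x ^ a * g y ^ b ≤ h (a * x + b * y)) :
    ENNReal.ofReal a * (∫⁻ x, f x) + ENNReal.ofReal b * (∫⁻ x, g x) ≤ ∫⁻ x, h x := by
  have hf1' : ∀ x, f x ≤ 1 := fun x => hf1 ▸ le_iSup f x
  have hg1' : ∀ x, g x ≤ 1 := fun x => hg1 ▸ le_iSup g x
  refine le_trans ?_ (lintegral_mono fun x => min_le_left (h x) 1)
  rw [lintegral_eq_lintegral_meas_lt_of_le_one hf hf1',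
    lintegral_eq_lintegral_meas_lt_of_le_one hg hg1',
    lintegral_eq_lintegral_meas_lt_of_le_one (hh.min measurable_const) fun x => min_le_right _ _,
    ← lintegral_const_mul' _ _ ENNReal.ofReal_ne_top,
    ← lintegral_const_mul' _ _ ENNReal.ofReal_ne_top]
  refine (le_lintegral_add _ _).trans ?_
  refine lintegral_mono fun t => ?_
  simp only
  rcases lt_or_ge (ENNReal.ofReal t) 1 with ht | ht
  · refine volume_convexCombo_le (measurableSet_lt measurable_const hf)
      (measurableSet_lt measurable_const hg) ?_ ?_ ha hb ?_
    · exact lt_iSup_iff.1 (hf1 ▸ ht)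
    · exact lt_iSup_iff.1 (hg1 ▸ ht)
    · intro x hx y hy
      refine lt_min (lt_of_lt_of_le ?_ (H x y)) ht
      calc ENNReal.ofReal t = ENNReal.ofReal t ^ a * ENNReal.ofReal t ^ b := by
            rw [← ENNReal.rpow_add_of_nonneg _ _ ha.le hb.le, hab, ENNReal.rpow_one]
        _ < f x ^ a * g y ^ b := ENNReal.mul_lt_mul (ENNReal.rpow_lt_rpow hx ha)
            (ENNReal.rpow_lt_rpow hy hb)
  · have e1 : {x | ENNReal.ofReal t < f x} = ∅ :=
      eq_empty_of_forall_notMem fun x hx => absurd (hf1' x) (not_le.2 (ht.trans_lt hx))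
    have e2 : {x | ENNReal.ofReal t < g x} = ∅ :=
      eq_empty_of_forall_notMem fun x hx => absurd (hg1' x) (not_le.2 (ht.trans_lt hx))
    simp [e1, e2]

theorem prekopaLeindler_real_of_iSup_ne_top {f g h : ℝ → ℝ≥0∞} (hf : Measurable f)
    (hg : Measurable g) (hh : Measurable h) {a b : ℝ} (ha : 0 < a) (hb : 0 < b) (hab : a + b = 1)
    (hf1 : ⨆ x, f x ≠ ∞) (hg1 : ⨆ x, g x ≠ ∞)
    (H : ∀ x y, f x ^ a * g y ^ b ≤ h (a * x + b * y)) :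
    (∫⁻ x, f x) ^ a * (∫⁻ x, g x) ^ b ≤ ∫⁻ x, h x := by
  set M := ⨆ x, f x with hM
  set N := ⨆ x, g x with hN
  rcases eq_or_ne M 0 with hM0 | hM0
  · have : ∀ x, f x = 0 := fun x => le_antisymm (hM0 ▸ le_iSup f x) zero_le
    simp [this, ENNReal.zero_rpow_of_pos ha]
  rcases eq_or_ne N 0 with hN0 | hN0
  · have : ∀ x, g x = 0 := fun x => le_antisymm (hN0 ▸ le_iSup g x) zero_le
    simp [this, ENNReal.zero_rpow_of_pos hb]
  have hMa0 : M ^ a ≠ 0 := by simp [hM0, hf1]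
  have hMat : M ^ a ≠ ∞ := by simp [hM0, hf1]
  have hNb0 : N ^ b ≠ 0 := by simp [hN0, hg1]
  have hNbt : N ^ b ≠ ∞ := by simp [hN0, hg1]
  have key := add_lintegral_le_of_iSup_eq_one (f := fun x => M⁻¹ * f x) (g := fun x => N⁻¹ * g x)
    (h := fun x => (M ^ a * N ^ b)⁻¹ * h x) (hf.const_mul _) (hg.const_mul _) (hh.const_mul _)
    ha hb hab (by rw [← ENNReal.mul_iSup, ← hM, ENNReal.inv_mul_cancel hM0 hf1])
    (by rw [← ENNReal.mul_iSup, ← hN, ENNReal.inv_mul_cancel hN0 hg1]) (by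
      intro x y
      rw [ENNReal.mul_rpow_of_nonneg _ _ ha.le, ENNReal.mul_rpow_of_nonneg _ _ hb.le,
        ENNReal.inv_rpow, ENNReal.inv_rpow,
        ENNReal.mul_inv (Or.inl hMa0) (Or.inl hMat), mul_mul_mul_comm]
      gcongr
      exact H x y)
  rw [lintegral_const_mul' _ _ (by simp [hM0]), lintegral_const_mul' _ _ (by simp [hN0]),
    lintegral_const_mul' _ _ (by simp [hMa0, hNb0])] at key
  have key2 := (ENNReal.geom_mean_le_arith_mean2 ha hb hab _ _).trans key
  rw [ENNReal.mul_rpow_of_nonneg _ _ ha.le, ENNReal.mul_rpow_of_nonneg _ _ hb.le,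
        ENNReal.inv_rpow, ENNReal.inv_rpow,
        ENNReal.mul_inv (Or.inl hMa0) (Or.inl hMat), mul_mul_mul_comm] at key2
  exact (ENNReal.mul_le_mul_iff_right (by simp [hMat, hNbt])
    (by simp [ENNReal.mul_eq_top, hMa0, hNb0])).1 key2

/-- The one-dimensional **Prékopa–Leindler inequality**. -/
theorem prekopaLeindler_real {f g h : ℝ → ℝ≥0∞} (hf : Measurable f)
    (hg : Measurable g) (hh : Measurable h) {a b : ℝ} (ha : 0 < a) (hb : 0 < b) (hab : a + b = 1)
    (H : ∀ x y, f x ^ a * g y ^ b ≤ h (a * x + b * y)) :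
    (∫⁻ x, f x) ^ a * (∫⁻ x, g x) ^ b ≤ ∫⁻ x, h x := by
  have approx : ∀ u : ℝ → ℝ≥0∞, Measurable u →
      Filter.Tendsto (fun k : ℕ => ∫⁻ x, min (u x) k) Filter.atTop (nhds (∫⁻ x, u x)) := by
    intro u hu
    refine lintegral_tendsto_of_tendsto_of_monotone (fun k => (hu.min measurable_const).aemeasurable)
      (ae_of_all _ fun x k l hkl => min_le_min_left _ (by exact_mod_cast hkl))
      (ae_of_all _ fun x => ?_)
    have := (tendsto_const_nhds (x := u x)).min ENNReal.tendsto_nat_nhds_top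
    simpa using this
  have bound : ∀ (u : ℝ → ℝ≥0∞) (k : ℕ), ⨆ x, min (u x) k ≠ ∞ := fun u k =>
    ((iSup_le fun x => min_le_right _ _).trans_lt (ENNReal.natCast_lt_top k)).ne
  have trunc : ∀ k l : ℕ, (∫⁻ x, min (f x) k) ^ a * (∫⁻ x, min (g x) l) ^ b ≤ ∫⁻ x, h x := by
    intro k l
    refine prekopaLeindler_real_of_iSup_ne_top (hf.min measurable_const) (hg.min measurable_const)
      hh ha hb hab (bound f k) (bound g l) fun x y => le_trans ?_ (H x y)
    gcongr <;> exact min_le_left _ _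
  have lim : ∀ (u : ℝ → ℝ≥0∞) (_ : Measurable u) (c : ℝ) (_ : 0 < c),
      (∫⁻ x, u x) ^ c = ⨆ k : ℕ, (∫⁻ x, min (u x) k) ^ c := by
    intro u hu c hc
    refine tendsto_nhds_unique ((ENNReal.continuous_rpow_const.tendsto _).comp (approx u hu)) ?_
    refine tendsto_atTop_iSup fun k l hkl => ?_
    simp only [Function.comp]
    gcongr
  rw [lim f hf a ha, lim g hg b hb, ENNReal.iSup_mul]
  refine iSup_le fun k => ?_
  rw [ENNReal.mul_iSup]
  exact iSup_le fun l => trunc k l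

/-- The **Prékopa–Leindler inequality** on `Fin n → ℝ`. -/
theorem prekopaLeindler_pi : ∀ {n : ℕ} {f g h : (Fin n → ℝ) → ℝ≥0∞} (_ : Measurable f)
    (_ : Measurable g) (_ : Measurable h) {a b : ℝ} (_ : 0 < a) (_ : 0 < b) (_ : a + b = 1)
    (_ : ∀ x y, f x ^ a * g y ^ b ≤ h (a • x + b • y)),
    (∫⁻ x, f x) ^ a * (∫⁻ x, g x) ^ b ≤ ∫⁻ x, h x
  | 0, f, g, h, hf, hg, hh, a, b, ha, hb, hab, H => by
    simp only [Measure.volume_pi_eq_dirac (default : Fin 0 → ℝ), lintegral_dirac]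
    exact (H default default).trans_eq (congrArg h (Subsingleton.elim _ _))
  | n + 1, f, g, h, hf, hg, hh, a, b, ha, hb, hab, H => by
    have heq : ∀ p : ℝ × (Fin n → ℝ), (MeasurableEquiv.piFinSuccAbove (fun _ => ℝ) 0).symm p =
        (Fin.cons p.1 p.2 : Fin (n + 1) → ℝ) := fun p => Fin.insertNth_zero' p.1 p.2
    have split : ∀ u : (Fin (n + 1) → ℝ) → ℝ≥0∞, Measurable u →
        ∫⁻ x, u x = ∫⁻ t : ℝ, ∫⁻ x : Fin n → ℝ, u (Fin.cons t x) := by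
      intro u hu
      have e := (volume_preserving_piFinSuccAbove (fun _ : Fin (n + 1) => ℝ) 0).symm
      rw [← e.lintegral_comp hu, Measure.volume_eq_prod, lintegral_prod]
      · simp_rw [heq]
      · exact (hu.comp (MeasurableEquiv.measurable _)).aemeasurable
    have hcons : Measurable fun p : ℝ × (Fin n → ℝ) => (Fin.cons p.1 p.2 : Fin (n + 1) → ℝ) := by
      simp_rw [← heq]
      exact (MeasurableEquiv.piFinSuccAbove (fun _ : Fin (n + 1) => ℝ) 0).symm.measurable
    have slice : ∀ u : (Fin (n + 1) → ℝ) → ℝ≥0∞, Measurable u →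
        Measurable fun t : ℝ => ∫⁻ x : Fin n → ℝ, u (Fin.cons t x) := fun u hu =>
      (hu.comp hcons).lintegral_prod_right'
    rw [split f hf, split g hg, split h hh]
    refine prekopaLeindler_real (slice f hf) (slice g hg) (slice h hh) ha hb hab fun s t => ?_
    have fib : ∀ (u : (Fin (n + 1) → ℝ) → ℝ≥0∞) (t : ℝ), Measurable u →
        Measurable fun x : Fin n → ℝ => u (Fin.cons t x) := fun u t hu =>
      (hu.comp hcons).comp measurable_prodMk_left
    refine prekopaLeindler_pi (fib f s hf) (fib g t hg) (fib h _ hh) ha hb hab fun x y => ?_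
    convert H (Fin.cons s x) (Fin.cons t y) using 2
    ext i
    refine Fin.cases ?_ (fun j => ?_) i <;> simp

/-- The **Prékopa–Leindler inequality** on Euclidean space. -/
theorem prekopaLeindler {n : ℕ} {f g h : EuclideanSpace ℝ (Fin n) → ℝ≥0∞} (hf : Measurable f)
    (hg : Measurable g) (hh : Measurable h) {a b : ℝ} (ha : 0 < a) (hb : 0 < b) (hab : a + b = 1)
    (H : ∀ x y, f x ^ a * g y ^ b ≤ h (a • x + b • y)) :
    (∫⁻ x, f x) ^ a * (∫⁻ x, g x) ^ b ≤ ∫⁻ x, h x := by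
  have e := PiLp.volume_preserving_toLp (Fin n)
  rw [← e.lintegral_comp hf, ← e.lintegral_comp hg, ← e.lintegral_comp hh]
  exact prekopaLeindler_pi (hf.comp e.measurable) (hg.comp e.measurable) (hh.comp e.measurable)
    ha hb hab fun x y => H _ _

theorem setLIntegral_smul_of_homogeneous {n : ℕ} {S : Set (EuclideanSpace ℝ (Fin n))}
    {ω : EuclideanSpace ℝ (Fin n) → ℝ≥0∞} (hω : Measurable ω) {α : ℝ}
    (hhom : ∀ x ∈ S, ∀ t : ℝ, 0 < t → ω (t • x) = ENNReal.ofReal (t ^ α) * ω x)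
    {A : Set (EuclideanSpace ℝ (Fin n))} (hA : MeasurableSet A) (hAS : A ⊆ S) {t : ℝ} (ht : 0 < t) :
    ∫⁻ x in (fun x => t⁻¹ • x) ⁻¹' A, ω x = ENNReal.ofReal (t ^ ((n : ℝ) + α)) * ∫⁻ x in A, ω x := by
  have hmeas : Measurable fun x : EuclideanSpace ℝ (Fin n) => t⁻¹ • x := measurable_const_smul _
  have hmap := Measure.map_addHaar_smul (volume : Measure (EuclideanSpace ℝ (Fin n)))
    (inv_ne_zero ht.ne')
  have h1 : ∫⁻ x in (fun x => t⁻¹ • x) ⁻¹' A, ω x =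
      ∫⁻ x, A.indicator (fun y => ω (t • y)) (t⁻¹ • x) := by
    rw [← lintegral_indicator (hmeas hA)]
    refine lintegral_congr fun x => ?_
    by_cases hx : t⁻¹ • x ∈ A
    · rw [indicator_of_mem (by exact hx), indicator_of_mem hx, smul_inv_smul₀ ht.ne']
    · rw [indicator_of_notMem (by exact hx), indicator_of_notMem hx]
  have hm2 : Measurable (A.indicator (fun y => ω (t • y))) :=
    (hω.comp (measurable_const_smul t)).indicator hA
  rw [h1, ← lintegral_map (f := A.indicator (fun y => ω (t • y))) hm2 hmeas]
  rw [hmap, lintegral_smul_measure, lintegral_indicator hA,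
    setLIntegral_congr_fun hA fun x hx => hhom x (hAS hx) t ht,
    lintegral_const_mul' _ _ ENNReal.ofReal_ne_top, smul_eq_mul, ← mul_assoc,
    ← ENNReal.ofReal_mul (abs_nonneg _)]
  congr 2
  rw [finrank_euclideanSpace_fin, inv_pow, inv_inv, abs_of_pos (pow_pos ht _),
    Real.rpow_add ht, Real.rpow_natCast]

open scoped Pointwise in
/-- The **Brunn–Minkowski inequality** for a log-concave weight that is homogeneous
of degree `α` in a convex cone. -/
theorem weighted_brunnMinkowski {n : ℕ} {S : Set (EuclideanSpace ℝ (Fin n))}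
    (hScone : ∀ x ∈ S, ∀ t : ℝ, 0 < t → t • x ∈ S)
    {ω : EuclideanSpace ℝ (Fin n) → ℝ≥0∞} (hω : Measurable ω) {α : ℝ}
    (hhom : ∀ x ∈ S, ∀ t : ℝ, 0 < t → ω (t • x) = ENNReal.ofReal (t ^ α) * ω x)
    (hlog : ∀ x ∈ S, ∀ y ∈ S, ∀ a b : ℝ, 0 < a → 0 < b → a + b = 1 →
      ω x ^ a * ω y ^ b ≤ ω (a • x + b • y))
    {A B : Set (EuclideanSpace ℝ (Fin n))} (hA : IsOpen A) (hB : IsOpen B)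
    (hAS : A ⊆ S) (hBS : B ⊆ S) (hABS : A + B ⊆ S) {a b : ℝ} (ha : 0 < a) (hb : 0 < b)
    (hmA : ∫⁻ x in A, ω x = ENNReal.ofReal (a ^ ((n : ℝ) + α)))
    (hmB : ∫⁻ x in B, ω x = ENNReal.ofReal (b ^ ((n : ℝ) + α))) :
    ENNReal.ofReal ((a + b) ^ ((n : ℝ) + α)) ≤ ∫⁻ x in A + B, ω x := by
  have hs : 0 < a + b := add_pos ha hb
  have normalize : ∀ (C : Set (EuclideanSpace ℝ (Fin n))) (c : ℝ), IsOpen C → C ⊆ S → 0 < c →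
      ∫⁻ x in (fun x => c • x) ⁻¹' C, ω x =
        ENNReal.ofReal (c ^ (-((n : ℝ) + α))) * ∫⁻ x in C, ω x := by
    intro C c hC hCS hc
    have := setLIntegral_smul_of_homogeneous hω hhom hC.measurableSet hCS (inv_pos.2 hc)
    rw [inv_inv] at this
    rw [this, Real.inv_rpow hc.le, Real.rpow_neg hc.le]
  have unit : ∀ (c : ℝ), 0 < c →
      ENNReal.ofReal (c ^ (-((n : ℝ) + α))) * ENNReal.ofReal (c ^ ((n : ℝ) + α)) = 1 := by
    intro c hc
    rw [← ENNReal.ofReal_mul (by positivity), ← Real.rpow_add hc, neg_add_cancel, Real.rpow_zero,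
      ENNReal.ofReal_one]
  have mem : ∀ (C : Set (EuclideanSpace ℝ (Fin n))) (c : ℝ), C ⊆ S → 0 < c →
      ∀ x ∈ (fun x => c • x) ⁻¹' C, x ∈ S := by
    intro C c hCS hc x hx
    simpa [smul_smul, inv_mul_cancel₀ hc.ne'] using hScone _ (hCS hx) c⁻¹ (inv_pos.2 hc)
  have meas : ∀ (C : Set (EuclideanSpace ℝ (Fin n))) (c : ℝ), IsOpen C →
      MeasurableSet ((fun x => c • x) ⁻¹' C) := fun C c hC =>
    (hC.preimage (continuous_const_smul c)).measurableSet
  have hAB : IsOpen (A + B) := hA.add_right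
  have key := prekopaLeindler (hω.indicator (meas A a hA)) (hω.indicator (meas B b hB))
    (hω.indicator (meas (A + B) (a + b) hAB)) (div_pos ha hs) (div_pos hb hs)
    (by field_simp) (by
      intro x y
      by_cases hx : x ∈ (fun x => a • x) ⁻¹' A
      swap
      · simp [indicator_of_notMem hx, ENNReal.zero_rpow_of_pos (div_pos ha hs)]
      by_cases hy : y ∈ (fun x => b • x) ⁻¹' B
      swap
      · simp [indicator_of_notMem hy, ENNReal.zero_rpow_of_pos (div_pos hb hs)]
      have hxy : (a / (a + b)) • x + (b / (a + b)) • y ∈ (fun x => (a + b) • x) ⁻¹' (A + B) := by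
        refine ⟨a • x, hx, b • y, hy, ?_⟩
        simp [smul_smul, mul_div_cancel₀ _ hs.ne']
      rw [indicator_of_mem hx, indicator_of_mem hy, indicator_of_mem hxy]
      exact hlog x (mem A a hAS ha x hx) y (mem B b hBS hb y hy) _ _ (div_pos ha hs)
        (div_pos hb hs) (by field_simp))
  rw [lintegral_indicator (meas A a hA), lintegral_indicator (meas B b hB),
    lintegral_indicator (meas (A + B) (a + b) hAB), normalize A a hA hAS ha,
    normalize B b hB hBS hb, normalize (A + B) (a + b) hAB hABS hs, hmA, hmB, unit a ha, unit b hb,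
    ENNReal.one_rpow, ENNReal.one_rpow, one_mul] at key
  calc ENNReal.ofReal ((a + b) ^ ((n : ℝ) + α))
      ≤ ENNReal.ofReal ((a + b) ^ ((n : ℝ) + α)) *
        (ENNReal.ofReal ((a + b) ^ (-((n : ℝ) + α))) * ∫⁻ x in A + B, ω x) :=
        le_mul_of_one_le_right zero_le key
    _ = ∫⁻ x in A + B, ω x := by
        rw [← mul_assoc, mul_comm (ENNReal.ofReal _) (ENNReal.ofReal _), unit _ hs, one_mul]

theorem exists_orthogonal_chart {m : ℕ} {v : EuclideanSpace ℝ (Fin (m + 1))} (hv : ‖v‖ = 1) :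
    ∃ ι : EuclideanSpace ℝ (Fin m) →ₗᵢ[ℝ] EuclideanSpace ℝ (Fin (m + 1)),
      (∀ z, ⟪ι z, v⟫ = 0) ∧ (∀ y, ∃ z, y = ι z + ⟪y, v⟫ • v) ∧
      MeasurePreserving (fun p : EuclideanSpace ℝ (Fin m) × ℝ => ι p.1 + p.2 • v)
        (volume.prod volume) volume := by
  obtain ⟨b, hb⟩ : ∃ b : OrthonormalBasis (Fin (m + 1)) ℝ (EuclideanSpace ℝ (Fin (m + 1))),
      b 0 = v := by
    obtain ⟨b, hb⟩ := Orthonormal.exists_orthonormalBasis_extension_of_card_eq (𝕜 := ℝ)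
      (ι := Fin (m + 1)) (v := fun _ => v) (s := {0}) (by simp)
      (by
        rw [orthonormal_iff_ite]
        rintro ⟨i, rfl⟩ ⟨j, rfl⟩
        simp [hv])
    exact ⟨b, hb 0 rfl⟩
  let J : EuclideanSpace ℝ (Fin m) →ₗᵢ[ℝ] EuclideanSpace ℝ (Fin (m + 1)) :=
    { toFun := fun z => WithLp.toLp 2 (Fin.cons 0 z.ofLp)
      map_add' := fun x y => by
        ext i
        refine Fin.cases ?_ (fun j => ?_) i <;> simp
      map_smul' := fun c x => by
        ext i
        refine Fin.cases ?_ (fun j => ?_) i <;> simp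
      norm_map' := fun z => by
        simp [EuclideanSpace.norm_eq, Fin.sum_univ_succ] }
  have hsum : ∀ (z : EuclideanSpace ℝ (Fin m)) (t : ℝ), b.repr.symm (J z) + t • v =
      b.repr.symm (WithLp.toLp 2 (Fin.cons t z.ofLp)) := by
    intro z t
    rw [← hb, ← b.repr_symm_single, ← map_smul, ← map_add]
    congr 1
    ext i
    refine Fin.cases ?_ (fun j => ?_) i <;> simp [J]
  refine ⟨b.repr.symm.toLinearIsometry.comp J, fun z => ?_, fun y => ?_, ?_⟩
  · rw [← hb, ← b.repr_symm_single]
    change ⟪b.repr.symm (J z), _⟫ = 0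
    rw [b.repr.symm.inner_map_map]
    simp [J, EuclideanSpace.inner_single_right]
  · refine ⟨WithLp.toLp 2 (Fin.tail (b.repr y).ofLp), ?_⟩
    change y = b.repr.symm (J _) + _
    rw [hsum, LinearIsometryEquiv.eq_symm_apply]
    ext i
    refine Fin.cases ?_ (fun j => ?_) i
    · simp [b.repr_apply_apply, hb, real_inner_comm]
    · simp [Fin.tail]
  · have h1 : MeasurePreserving (fun p : EuclideanSpace ℝ (Fin m) × ℝ => (p.1.ofLp, p.2))
        (volume.prod volume) (volume.prod volume) :=
      (PiLp.volume_preserving_ofLp (Fin m)).prod (MeasurePreserving.id _)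
    have h2 := ((b.measurePreserving_repr_symm.comp (PiLp.volume_preserving_toLp (Fin (m + 1)))).comp
      (volume_preserving_piFinSuccAbove (fun _ : Fin (m + 1) => ℝ) 0).symm).comp
      (Measure.measurePreserving_swap.comp h1)
    convert h2 using 1
    ext1 p
    change b.repr.symm (J p.1) + p.2 • v = _
    rw [hsum]
    simp only [Function.comp, Prod.swap]
    congr 2
    exact (Fin.insertNth_zero' p.2 p.1.ofLp).symm

/-- The factor by which the graph of a linear functional `a` stretches volume. -/
def graphJacobian {F : Type*} [SeminormedAddCommGroup F] [NormedSpace ℝ F] (a : F →L[ℝ] ℝ) : ℝ :=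
  √(1 + ‖a‖ ^ 2)

theorem euclideanHausdorffMeasure_image_linearMap {m n : ℕ}
    (L : EuclideanSpace ℝ (Fin m) →ₗ[ℝ] EuclideanSpace ℝ (Fin n)) (hL : Function.Injective L)
    (A : Set (EuclideanSpace ℝ (Fin m))) :
    μHE[m] (L '' A) = ENNReal.ofReal L.normDet * volume A := by
  obtain ⟨b⟩ := (L.normDet_ne_zero_tfae.out 4 3).1 hL
  let b' := b.reindex (finCongr (finrank_euclideanSpace_fin (𝕜 := ℝ) (n := m)))
  let M : EuclideanSpace ℝ (Fin m) →ₗ[ℝ] EuclideanSpace ℝ (Fin m) :=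
    b'.repr.toLinearEquiv.toLinearMap ∘ₗ L.rangeRestrict
  let g : EuclideanSpace ℝ (Fin m) →ₗᵢ[ℝ] EuclideanSpace ℝ (Fin n) :=
    (LinearMap.range L).subtypeₗᵢ.comp b'.repr.symm.toLinearIsometry
  have hLM : L = g.toLinearMap ∘ₗ M := by
    ext1 x
    simp [g, M]
  have hdet : L.normDet = |M.det| := by
    conv_lhs => rw [hLM]
    rw [LinearMap.normDet_comp_of_finrank_eq _ _ rfl, g.normDet_eq_one, one_mul,
      LinearMap.normDet_eq_norm_det, Real.norm_eq_abs]
  have himg : L '' A = g '' (M '' A) := by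
    conv_lhs => rw [hLM]
    rw [← image_comp]
    rfl
  rw [himg, g.isometry.euclideanHausdorffMeasure_image,
    EuclideanSpace.euclideanHausdorffMeasure_eq_volume, Measure.addHaar_image_linearMap, hdet]

theorem normDet_graph {m n : ℕ} {v : EuclideanSpace ℝ (Fin n)} (hv : ‖v‖ = 1)
    (ι : EuclideanSpace ℝ (Fin m) →ₗᵢ[ℝ] EuclideanSpace ℝ (Fin n)) (hι : ∀ z, ⟪ι z, v⟫ = 0)
    (a : EuclideanSpace ℝ (Fin m) →L[ℝ] ℝ) :
    (ι.toLinearMap + a.toLinearMap.smulRight v).normDet = graphJacobian a := by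
  let u := (InnerProductSpace.toDual ℝ (EuclideanSpace ℝ (Fin m))).symm a
  have hu : ∀ z, ⟪u, z⟫ = a z := fun z => InnerProductSpace.toDual_symm_apply
  have hun : ‖u‖ = ‖a‖ := LinearIsometryEquiv.norm_map _ _
  have hadj : LinearMap.adjoint (ι.toLinearMap + a.toLinearMap.smulRight v) ∘ₗ
      (ι.toLinearMap + a.toLinearMap.smulRight v) = LinearMap.transvection a.toLinearMap u := by
    refine LinearMap.ext fun z => ext_inner_right ℝ fun z' => ?_
    rw [LinearMap.comp_apply, LinearMap.adjoint_inner_left]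
    have hι' : ∀ z, ⟪v, ι z⟫ = 0 := fun z => by rw [real_inner_comm, hι]
    simp [LinearMap.transvection, inner_add_left, inner_add_right, inner_smul_left,
      inner_smul_right, hι, hι', hu, hv, mul_comm]
  have hsq := LinearMap.normDet_sq (𝕜 := ℝ) (ι.toLinearMap + a.toLinearMap.smulRight v)
  rw [hadj, LinearMap.transvection.det] at hsq
  have hau : a u = ‖a‖ ^ 2 := by rw [← hu, real_inner_self_eq_norm_sq, hun]
  rw [graphJacobian, eq_comm, Real.sqrt_eq_iff_mul_self_eq (by positivity)
    (LinearMap.normDet_nonneg _), ← sq]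
  have : (1 : ℝ) + ‖a‖ ^ 2 = 1 + a.toLinearMap u := by rw [← hau]; rfl
  rw [this]
  simpa using hsq.symm

theorem norm_add_smul_sq {m n : ℕ} {v : EuclideanSpace ℝ (Fin n)} (hv : ‖v‖ = 1)
    (ι : EuclideanSpace ℝ (Fin m) →ₗᵢ[ℝ] EuclideanSpace ℝ (Fin n)) (hι : ∀ z, ⟪ι z, v⟫ = 0)
    (z : EuclideanSpace ℝ (Fin m)) (t : ℝ) : ‖ι z + t • v‖ ^ 2 = ‖z‖ ^ 2 + t ^ 2 := by
  rw [norm_add_sq_real, inner_smul_right, hι, norm_smul, hv, ι.norm_map, Real.norm_eq_abs]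
  simp

theorem norm_le_norm_add_smul {m n : ℕ} {v : EuclideanSpace ℝ (Fin n)} (hv : ‖v‖ = 1)
    (ι : EuclideanSpace ℝ (Fin m) →ₗᵢ[ℝ] EuclideanSpace ℝ (Fin n)) (hι : ∀ z, ⟪ι z, v⟫ = 0)
    (z : EuclideanSpace ℝ (Fin m)) (t : ℝ) : ‖z‖ ≤ ‖ι z + t • v‖ := by
  refine le_of_sq_le_sq ?_ (norm_nonneg _)
  rw [norm_add_smul_sq hv ι hι]
  nlinarith [sq_nonneg t]

theorem continuous_graphJacobian {m : ℕ} :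
    Continuous (graphJacobian : (EuclideanSpace ℝ (Fin m) →L[ℝ] ℝ) → ℝ) := by
  unfold graphJacobian
  fun_prop

theorem graphJacobian_nonneg {F : Type*} [SeminormedAddCommGroup F] [NormedSpace ℝ F]
    (a : F →L[ℝ] ℝ) : 0 ≤ graphJacobian a := Real.sqrt_nonneg _

theorem graphJacobian_le_mul {F : Type*} [SeminormedAddCommGroup F] [NormedSpace ℝ F]
    {a b : F →L[ℝ] ℝ} {δ : ℝ} (hδ : 0 ≤ δ) (h : ‖a - b‖ ≤ δ) :
    graphJacobian a ≤ (1 + δ) * graphJacobian b := by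
  have hab : ‖a‖ ≤ ‖b‖ + δ := by
    have := norm_le_norm_add_norm_sub' a b
    linarith
  unfold graphJacobian
  have hb := norm_nonneg b
  rw [Real.sqrt_le_left (by positivity), mul_pow, Real.sq_sqrt (by positivity)]
  have h2 : ‖a‖ ^ 2 ≤ (‖b‖ + δ) ^ 2 := by gcongr
  nlinarith [mul_nonneg hδ (sq_nonneg (‖b‖ - 1)), mul_nonneg (sq_nonneg δ) (sq_nonneg ‖b‖)]

theorem LipschitzOnWith.euclideanHausdorffMeasure_image_le {X Y : Type*} [EMetricSpace X]
    [EMetricSpace Y] [MeasurableSpace X] [BorelSpace X] [MeasurableSpace Y] [BorelSpace Y]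
    {K : ℝ≥0} {f : X → Y} {s : Set X} (h : LipschitzOnWith K f s) (d : ℕ) :
    μHE[d] (f '' s) ≤ (K : ℝ≥0∞) ^ d * μHE[d] s := by
  have := h.hausdorffMeasure_image_le (d := d) (Nat.cast_nonneg d)
  rw [ENNReal.rpow_natCast] at this
  simp only [Measure.euclideanHausdorffMeasure_def, Measure.smul_apply, ENNReal.smul_def,
    smul_eq_mul]
  rw [mul_left_comm]
  gcongr

theorem continuous_graph {m n : ℕ} {v : EuclideanSpace ℝ (Fin n)}
    (ι : EuclideanSpace ℝ (Fin m) →ₗᵢ[ℝ] EuclideanSpace ℝ (Fin n))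
    {ψ : EuclideanSpace ℝ (Fin m) → ℝ} (hψ : Continuous ψ) :
    Continuous (fun z => ι z + ψ z • v) := by
  have := ι.continuous
  fun_prop

theorem injective_graph {m n : ℕ} {v : EuclideanSpace ℝ (Fin n)} (hv : ‖v‖ = 1)
    (ι : EuclideanSpace ℝ (Fin m) →ₗᵢ[ℝ] EuclideanSpace ℝ (Fin n)) (hι : ∀ z, ⟪ι z, v⟫ = 0)
    (ψ : EuclideanSpace ℝ (Fin m) → ℝ) : Function.Injective (fun z => ι z + ψ z • v) := by
  intro x y h
  have h0 : ι (x - y) + (ψ x - ψ y) • v = 0 := by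
    rw [map_sub, sub_smul]
    simp only at h
    rw [sub_add_sub_comm, h, sub_self]
  have := norm_le_norm_add_smul hv ι hι (x - y) (ψ x - ψ y)
  rw [h0, norm_zero] at this
  exact sub_eq_zero.1 (norm_le_zero_iff.1 this)

/-- On a piece where `ψ` is almost affine, the volume of the approximating plane is controlled
by the Hausdorff measure of the graph. -/
theorem volume_le_of_approximatesLinearOn {m n : ℕ} {v : EuclideanSpace ℝ (Fin n)} (hv : ‖v‖ = 1)
    (ι : EuclideanSpace ℝ (Fin m) →ₗᵢ[ℝ] EuclideanSpace ℝ (Fin n)) (hι : ∀ z, ⟪ι z, v⟫ = 0)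
    {ψ : EuclideanSpace ℝ (Fin m) → ℝ} {a : EuclideanSpace ℝ (Fin m) →L[ℝ] ℝ}
    {P : Set (EuclideanSpace ℝ (Fin m))} {δ : ℝ≥0} (h : ApproximatesLinearOn ψ a P δ) :
    ENNReal.ofReal (graphJacobian a) * volume P ≤
      ((1 + δ : ℝ≥0) : ℝ≥0∞) ^ m * μHE[m] ((fun z => ι z + ψ z • v) '' P) := by
  set G := fun z => ι z + ψ z • v
  set L : EuclideanSpace ℝ (Fin m) →ₗ[ℝ] EuclideanSpace ℝ (Fin n) :=
    ι.toLinearMap + a.toLinearMap.smulRight v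
  have hLapp : ∀ z, L z = ι z + a z • v := fun z => rfl
  have hL : Function.Injective L := injective_graph hv ι hι a
  have hG : Function.Injective G := injective_graph hv ι hι ψ
  rw [← normDet_graph hv ι hι a, ← euclideanHausdorffMeasure_image_linearMap L hL]
  have himg : L '' P = (L ∘ Function.invFun G) '' (G '' P) := by
    rw [← image_comp, Function.comp_assoc, Function.invFun_comp hG, Function.comp_id]
  rw [himg]
  refine LipschitzOnWith.euclideanHausdorffMeasure_image_le
    (LipschitzOnWith.of_dist_le_mul ?_) m
  rintro _ ⟨x, hx, rfl⟩ _ ⟨y, hy, rfl⟩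
  simp only [Function.comp, Function.leftInverse_invFun hG _, dist_eq_norm]
  have hGd : G x - G y = ι (x - y) + (ψ x - ψ y) • v := by
    simp only [G, map_sub, sub_smul]; abel
  have h1 : L x - L y = (G x - G y) - (ψ x - ψ y - a (x - y)) • v := by
    rw [← map_sub, hLapp, hGd]; module
  have h2 : ‖x - y‖ ≤ ‖G x - G y‖ := by
    rw [hGd]; exact norm_le_norm_add_smul hv ι hι _ _
  calc ‖L x - L y‖ ≤ ‖G x - G y‖ + ‖(ψ x - ψ y - a (x - y)) • v‖ := by
        rw [h1]; exact norm_sub_le _ _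
    _ ≤ ‖G x - G y‖ + δ * ‖x - y‖ := by
        rw [norm_smul, hv, mul_one]
        gcongr
        exact h x hx y hy
    _ ≤ ‖G x - G y‖ + δ * ‖G x - G y‖ := by gcongr
    _ = ((1 + δ : ℝ≥0) : ℝ) * ‖G x - G y‖ := by push_cast; ring

theorem lintegral_graphJacobian_le_mul {m n : ℕ} {v : EuclideanSpace ℝ (Fin n)} (hv : ‖v‖ = 1)
    (ι : EuclideanSpace ℝ (Fin m) →ₗᵢ[ℝ] EuclideanSpace ℝ (Fin n)) (hι : ∀ z, ⟪ι z, v⟫ = 0)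
    {ψ : EuclideanSpace ℝ (Fin m) → ℝ} (hψc : Continuous ψ)
    {A : Set (EuclideanSpace ℝ (Fin m))} (hA : MeasurableSet A)
    (hψ : ∀ z ∈ A, DifferentiableAt ℝ ψ z) {δ : ℝ≥0} (hδ : 0 < δ) :
    ∫⁻ z in A, ENNReal.ofReal (graphJacobian (fderiv ℝ ψ z)) ≤
      ((1 + δ : ℝ≥0) : ℝ≥0∞) ^ (m + 1) * μHE[m] ((fun z => ι z + ψ z • v) '' A) := by
  set G := fun z => ι z + ψ z • v
  have hGc : Continuous G := continuous_graph ι hψc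
  have hG : Function.Injective G := injective_graph hv ι hι ψ
  have hGimg : ∀ s, MeasurableSet s → MeasurableSet (G '' s) := fun s hs =>
    hs.image_of_continuousOn_injOn hGc.continuousOn hG.injOn
  -- a countable measurable partition on which the derivative is almost constant
  have small : ∀ s ⊆ A, MeasurableSet s →
      (∃ b, ∀ z ∈ s, ‖fderiv ℝ ψ z - b‖ ≤ δ / 2) →
      ∫⁻ z in s, ENNReal.ofReal (graphJacobian (fderiv ℝ ψ z)) ≤
        ((1 + δ : ℝ≥0) : ℝ≥0∞) ^ (m + 1) * μHE[m] (G '' s) := by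
    rintro s hsA hs ⟨b, hb⟩
    rcases s.eq_empty_or_nonempty with rfl | hne
    · simp
    obtain ⟨t, a, t_disj, t_meas, t_cover, ht, ha⟩ :=
      exists_partition_approximatesLinearOn_of_hasFDerivWithinAt ψ s (fderiv ℝ ψ)
        (fun x hx => (hψ x (hsA hx)).hasFDerivAt.hasFDerivWithinAt) (fun _ => δ) fun _ => hδ.ne'
    have hdec : s = ⋃ i, s ∩ t i := by
      rw [← inter_iUnion, inter_eq_self_of_subset_left t_cover]
    have hdisj : Pairwise (Function.onFun Disjoint fun i => s ∩ t i) := fun i j hij =>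
      (t_disj hij).mono inter_subset_right inter_subset_right
    have hGdisj : Pairwise (Function.onFun Disjoint fun i => G '' (s ∩ t i)) := fun i j hij =>
      (disjoint_image_iff hG).2 (hdisj hij)
    conv_lhs => rw [hdec]
    conv_rhs => rw [hdec]
    rw [image_iUnion, measure_iUnion hGdisj fun i => hGimg _ (hs.inter (t_meas i)),
      lintegral_iUnion (fun i => hs.inter (t_meas i)) hdisj, ← ENNReal.tsum_mul_left]
    refine ENNReal.tsum_le_tsum fun i => ?_
    obtain ⟨y, hy, hay⟩ := ha hne i
    calc ∫⁻ z in s ∩ t i, ENNReal.ofReal (graphJacobian (fderiv ℝ ψ z))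
        ≤ ∫⁻ z in s ∩ t i, ((1 + δ : ℝ≥0) : ℝ≥0∞) * ENNReal.ofReal (graphJacobian (a i)) := by
          refine setLIntegral_mono' (hs.inter (t_meas i)) fun z hz => ?_
          have hle : ‖fderiv ℝ ψ z - a i‖ ≤ δ := by
            rw [hay]
            calc ‖fderiv ℝ ψ z - fderiv ℝ ψ y‖
                ≤ ‖fderiv ℝ ψ z - b‖ + ‖fderiv ℝ ψ y - b‖ := by
                  simpa using norm_sub_le (fderiv ℝ ψ z - b) (fderiv ℝ ψ y - b)
              _ ≤ δ / 2 + δ / 2 := add_le_add (hb z hz.1) (hb y hy)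
              _ = δ := add_halves _
          refine (ENNReal.ofReal_le_ofReal (graphJacobian_le_mul δ.2 hle)).trans_eq ?_
          rw [ENNReal.ofReal_mul (add_nonneg zero_le_one δ.2)]
          congr 1
          rw [← ENNReal.ofReal_coe_nnreal]
          simp
      _ = ((1 + δ : ℝ≥0) : ℝ≥0∞) * (ENNReal.ofReal (graphJacobian (a i)) * volume (s ∩ t i)) := by
          rw [setLIntegral_const, mul_assoc]
      _ ≤ ((1 + δ : ℝ≥0) : ℝ≥0∞) * (((1 + δ : ℝ≥0) : ℝ≥0∞) ^ m * μHE[m] (G '' (s ∩ t i))) := by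
          exact mul_le_mul' le_rfl <| volume_le_of_approximatesLinearOn hv ι hι (ht i)
      _ = ((1 + δ : ℝ≥0) : ℝ≥0∞) ^ (m + 1) * μHE[m] (G '' (s ∩ t i)) := by
          rw [← mul_assoc, pow_succ']
  let c : ℕ → Set (EuclideanSpace ℝ (Fin m) →L[ℝ] ℝ) :=
    disjointed fun i => closedBall (TopologicalSpace.denseSeq _ i) (δ / 2 : ℝ)
  have hcm : ∀ i, MeasurableSet (c i) :=
    MeasurableSet.disjointed fun i => measurableSet_closedBall
  have hcover : ∀ b, ∃ i, b ∈ c i := by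
    intro b
    have : b ∈ ⋃ i, c i := by
      rw [iUnion_disjointed]
      obtain ⟨i, hi⟩ :=
        (TopologicalSpace.denseRange_denseSeq (EuclideanSpace ℝ (Fin m) →L[ℝ] ℝ)).exists_dist_lt b (ε := (δ / 2 : ℝ))
          (by positivity)
      exact mem_iUnion.2 ⟨i, mem_closedBall.2 hi.le⟩
    exact mem_iUnion.1 this
  have hpm : ∀ i, MeasurableSet (A ∩ fderiv ℝ ψ ⁻¹' c i) := fun i =>
    hA.inter (measurable_fderiv ℝ ψ (hcm i))
  have hdec : A = ⋃ i, A ∩ fderiv ℝ ψ ⁻¹' c i := by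
    rw [← inter_iUnion, eq_comm, inter_eq_left]
    intro z _
    obtain ⟨i, hi⟩ := hcover (fderiv ℝ ψ z)
    exact mem_iUnion.2 ⟨i, hi⟩
  have hdisj : Pairwise (Function.onFun Disjoint fun i => A ∩ fderiv ℝ ψ ⁻¹' c i) := fun i j hij =>
    ((disjoint_disjointed _ hij).preimage _).mono inter_subset_right inter_subset_right
  have hGdisj : Pairwise (Function.onFun Disjoint fun i => G '' (A ∩ fderiv ℝ ψ ⁻¹' c i)) :=
    fun i j hij => (disjoint_image_iff hG).2 (hdisj hij)
  conv_lhs => rw [hdec]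
  conv_rhs => rw [hdec]
  rw [image_iUnion, measure_iUnion hGdisj fun i => hGimg _ (hpm i),
    lintegral_iUnion hpm hdisj, ← ENNReal.tsum_mul_left]
  refine ENNReal.tsum_le_tsum fun i => small _ inter_subset_left (hpm i)
    ⟨TopologicalSpace.denseSeq _ i, fun z hz => ?_⟩
  have : fderiv ℝ ψ z ∈ closedBall (TopologicalSpace.denseSeq _ i) (δ / 2 : ℝ) :=
    disjointed_subset (fun i => closedBall (TopologicalSpace.denseSeq _ i) (δ / 2 : ℝ)) i hz.2
  rwa [mem_closedBall, dist_eq_norm] at this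

theorem ENNReal.le_of_forall_one_add_pow_mul {x y : ℝ≥0∞} {k : ℕ}
    (h : ∀ δ : ℝ≥0, 0 < δ → x ≤ ((1 + δ : ℝ≥0) : ℝ≥0∞) ^ k * y) : x ≤ y := by
  rcases eq_or_ne y ∞ with rfl | hy
  · exact le_top
  have hc : Filter.Tendsto (fun δ : ℝ≥0 => ((1 + δ : ℝ≥0) : ℝ≥0∞) ^ k * y) (nhds 0) (nhds y) := by
    have h1 : Continuous fun δ : ℝ≥0 => (((1 + δ) ^ k * y.toNNReal : ℝ≥0) : ℝ≥0∞) := by fun_prop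
    have h2 := h1.tendsto 0
    simpa [ENNReal.coe_toNNReal hy] using h2
  exact ge_of_tendsto (hc.mono_left (nhdsWithin_le_nhds (s := Ioi 0)))
    (Filter.eventually_of_mem self_mem_nhdsWithin fun δ hδ => h δ hδ)

/-- Lower bound in the **area formula** for Lipschitz graphs. -/
theorem lintegral_graphJacobian_le {m n : ℕ} {v : EuclideanSpace ℝ (Fin n)} (hv : ‖v‖ = 1)
    (ι : EuclideanSpace ℝ (Fin m) →ₗᵢ[ℝ] EuclideanSpace ℝ (Fin n)) (hι : ∀ z, ⟪ι z, v⟫ = 0)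
    {ψ : EuclideanSpace ℝ (Fin m) → ℝ} {K : ℝ≥0} (hψ : LipschitzWith K ψ)
    {A : Set (EuclideanSpace ℝ (Fin m))} (hA : MeasurableSet A) :
    ∫⁻ z in A, ENNReal.ofReal (graphJacobian (fderiv ℝ ψ z)) ≤
      μHE[m] ((fun z => ι z + ψ z • v) '' A) := by
  have hd : MeasurableSet {z | DifferentiableAt ℝ ψ z} := measurableSet_of_differentiableAt ℝ ψ
  have hae : (A ∩ {z | DifferentiableAt ℝ ψ z} : Set _) =ᵐ[volume] A := by
    refine inter_ae_eq_left_of_ae_eq_univ (Filter.eventuallyEq_univ.2 hψ.ae_differentiableAt)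
  rw [← setLIntegral_congr hae]
  refine ENNReal.le_of_forall_one_add_pow_mul (k := m + 1) fun δ hδ =>
    (lintegral_graphJacobian_le_mul hv ι hι hψ.continuous (hA.inter hd) (fun z hz => hz.2) hδ).trans ?_
  gcongr
  exact inter_subset_left

theorem lintegral_comp_graph_le {m n : ℕ} {v : EuclideanSpace ℝ (Fin n)} (hv : ‖v‖ = 1)
    (ι : EuclideanSpace ℝ (Fin m) →ₗᵢ[ℝ] EuclideanSpace ℝ (Fin n)) (hι : ∀ z, ⟪ι z, v⟫ = 0)
    {ψ : EuclideanSpace ℝ (Fin m) → ℝ} {K : ℝ≥0} (hψ : LipschitzWith K ψ)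
    {A : Set (EuclideanSpace ℝ (Fin m))} (hA : MeasurableSet A)
    {f : EuclideanSpace ℝ (Fin n) → ℝ≥0∞} (hf : Measurable f) :
    ∫⁻ z in A, ENNReal.ofReal (graphJacobian (fderiv ℝ ψ z)) * f (ι z + ψ z • v) ≤
      ∫⁻ x in (fun z => ι z + ψ z • v) '' A, f x ∂μHE[m] := by
  set G := fun z => ι z + ψ z • v
  have hGm : Measurable G := (continuous_graph ι hψ.continuous).measurable
  have hJ : Measurable fun z => ENNReal.ofReal (graphJacobian (fderiv ℝ ψ z)) :=
    (continuous_graphJacobian.measurable.comp (measurable_fderiv ℝ ψ)).ennreal_ofReal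
  have hle : ((volume.restrict A).withDensity
      fun z => ENNReal.ofReal (graphJacobian (fderiv ℝ ψ z))).map G ≤ μHE[m].restrict (G '' A) := by
    refine Measure.le_iff.2 fun B hB => ?_
    rw [Measure.map_apply hGm hB, withDensity_apply _ (hGm hB), Measure.restrict_restrict (hGm hB),
      Measure.restrict_apply hB]
    refine (lintegral_graphJacobian_le hv ι hι hψ ((hGm hB).inter hA)).trans (measure_mono ?_)
    rintro _ ⟨z, hz, rfl⟩
    exact ⟨hz.1, z, hz.2, rfl⟩
  calc ∫⁻ z in A, ENNReal.ofReal (graphJacobian (fderiv ℝ ψ z)) * f (G z)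
      = ∫⁻ x, f x ∂(((volume.restrict A).withDensity
          fun z => ENNReal.ofReal (graphJacobian (fderiv ℝ ψ z))).map G) := by
        rw [lintegral_map hf hGm]
        exact (lintegral_withDensity_eq_lintegral_mul _ hJ (hf.comp hGm)).symm
    _ ≤ _ := lintegral_mono' hle le_rfl

theorem lintegral_eq_mul_lintegral_comp_affine {ε : ℝ} (hε : 0 < ε) (c : ℝ) {g : ℝ → ℝ≥0∞}
    (hg : Measurable g) : ∫⁻ t, g t = ENNReal.ofReal ε * ∫⁻ τ, g (c - ε * τ) := by
  have h2 : ∫⁻ t, g t = ∫⁻ t, g (c - t) := (lintegral_sub_left_eq_self g c).symm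
  have hm : Measurable fun t => g (c - t) := by fun_prop
  rw [h2]
  conv_lhs => rw [← Real.smul_map_volume_mul_left hε.ne']
  rw [lintegral_smul_measure, lintegral_map hm (by fun_prop), abs_of_pos hε, smul_eq_mul]

section LocalGraph

variable {m n : ℕ} {v : EuclideanSpace ℝ (Fin n)}
  {ι : EuclideanSpace ℝ (Fin m) →ₗᵢ[ℝ] EuclideanSpace ℝ (Fin n)}
  {ψ : EuclideanSpace ℝ (Fin m) → ℝ} {K : ℝ≥0} {x : EuclideanSpace ℝ (Fin n)} {r : ℝ}
  {Ω S : Set (EuclideanSpace ℝ (Fin n))}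

theorem exists_close_point_above_graph
    (hsurj : ∀ y, ∃ z, ∃ t : ℝ, y = ι z + t • v)
    (hΩ : ∀ z t, ι z + t • v ∈ ball x r → (ι z + t • v ∈ Ω ↔ ψ z < t))
    {ε : ℝ} (hε : ε ≤ r / 2) {z : EuclideanSpace ℝ (Fin m)} {t : ℝ}
    (hball : ι z + t • v ∈ ball x (r / 2)) (hmem : ι z + t • v ∈ thickening ε Ω) :
    ∃ z' t', ψ z' < t' ∧ ‖ι (z' - z) + (t' - t) • v‖ < ε := by
  obtain ⟨y, hy, hd⟩ := mem_thickening_iff.1 hmem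
  obtain ⟨z', t', rfl⟩ := hsurj y
  have hb : ι z' + t' • v ∈ ball x r := by
    rw [mem_ball] at hball ⊢
    linarith [dist_triangle_left (ι z' + t' • v) x (ι z + t • v)]
  refine ⟨z', t', (hΩ z' t' hb).1 hy, ?_⟩
  rw [dist_comm, dist_eq_norm] at hd
  have heq : ι (z' - z) + (t' - t) • v = ι z' + t' • v - (ι z + t • v) := by
    rw [map_sub]
    module
  rwa [heq]

theorem sub_le_of_close_point_above_graph (hv : ‖v‖ = 1) (hι : ∀ z, ⟪ι z, v⟫ = 0)
    (hψ : LipschitzWith K ψ) {ε : ℝ} {z z' : EuclideanSpace ℝ (Fin m)} {t t' : ℝ}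
    (habove : ψ z' < t') (hclose : ‖ι (z' - z) + (t' - t) • v‖ < ε) :
    ψ z - t ≤ ε * (1 + K) := by
  have h1 := (norm_le_norm_add_smul hv ι hι (z' - z) (t' - t)).trans hclose.le
  have h2 : t' - t ≤ ε := by
    refine le_trans ?_ hclose.le
    refine le_of_sq_le_sq ?_ (norm_nonneg _)
    rw [norm_add_smul_sq hv ι hι]
    nlinarith [sq_nonneg ‖z' - z‖]
  have h3 := hψ.dist_le_mul z z'
  rw [Real.dist_eq, dist_comm, dist_eq_norm] at h3
  have h4 : (K : ℝ) * ‖z' - z‖ ≤ K * ε := by gcongr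
  linarith [le_abs_self (ψ z - ψ z')]

theorem sub_lt_of_close_point_above_graph (hv : ‖v‖ = 1) (hι : ∀ z, ⟪ι z, v⟫ = 0)
    {z : EuclideanSpace ℝ (Fin m)} (hψ : DifferentiableAt ℝ ψ z) {τ : ℝ}
    (hτ : graphJacobian (fderiv ℝ ψ z) < τ) :
    ∃ δ > 0, ∀ ε ≤ δ, ∀ z' t t', ψ z' < t' → ‖ι (z' - z) + (t' - t) • v‖ < ε →
      ψ z - t < ε * τ := by
  have hη : 0 < τ - graphJacobian (fderiv ℝ ψ z) := sub_pos.2 hτ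
  have := (hasFDerivAt_iff_isLittleO.1 hψ.hasFDerivAt).def hη
  obtain ⟨δ, hδ, hball⟩ := Metric.eventually_nhds_iff.1 this
  refine ⟨δ, hδ, fun ε hε z' t t' habove hclose => ?_⟩
  have h1 := (norm_le_norm_add_smul hv ι hι (z' - z) (t' - t)).trans_lt hclose
  have h2 := hball (y := z') (by rw [dist_eq_norm]; linarith)
  have h3 := (abs_le.1 ((Real.norm_eq_abs _).symm.trans_le h2)).1
  have h4 := (fderiv ℝ ψ z).le_opNorm (z' - z)
  have h5 := (abs_le.1 ((Real.norm_eq_abs _).symm.trans_le h4)).1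
  set a := ‖fderiv ℝ ψ z‖
  set J := graphJacobian (fderiv ℝ ψ z) with hJ
  have hε0 : 0 < ε := (norm_nonneg _).trans_lt hclose
  have h6 : (t' - t) + a * ‖z' - z‖ ≤ J * ε := by
    refine le_of_sq_le_sq ?_ (mul_nonneg (graphJacobian_nonneg _) hε0.le)
    have hsq : ‖z' - z‖ ^ 2 + (t' - t) ^ 2 ≤ ε ^ 2 := by
      rw [← norm_add_smul_sq hv ι hι]; gcongr
    have hJ2 : J ^ 2 = 1 + a ^ 2 := Real.sq_sqrt (by positivity)
    rw [mul_pow, hJ2]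
    nlinarith [sq_nonneg (a * (t' - t) - ‖z' - z‖), sq_nonneg a]
  have h7 : (τ - J) * ‖z' - z‖ ≤ (τ - J) * ε := by gcongr
  linarith

theorem graph_mem_of_below_mem
    (hΩ : ∀ z t, ι z + t • v ∈ ball x r → (ι z + t • v ∈ Ω ↔ ψ z < t))
    (hS : Convex ℝ S) (hΩS : Ω ⊆ S) {z : EuclideanSpace ℝ (Fin m)} {t : ℝ} (ht : t ≤ ψ z)
    (hb : ι z + ψ z • v ∈ ball x r) (hmem : ι z + t • v ∈ S) : ι z + ψ z • v ∈ S := by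
  have hc : Continuous fun t : ℝ => ι z + t • v := by fun_prop
  have hev : ∀ᶠ s in nhdsWithin (ψ z) (Ioi (ψ z)), ι z + s • v ∈ ball x r :=
    (hc.tendsto (ψ z)).mono_left nhdsWithin_le_nhds (isOpen_ball.mem_nhds hb)
  obtain ⟨s, hs1, hs2⟩ := (hev.and self_mem_nhdsWithin).exists
  have hs : ι z + s • v ∈ S := hΩS ((hΩ _ _ hs1).2 hs2)
  have hconv : Convex ℝ ((fun t : ℝ => ι z + t • v) ⁻¹' S) := by
    have := (hS.translate_preimage_right (ι z)).linear_preimage (LinearMap.toSpanSingleton ℝ _ v)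
    simpa [preimage_preimage] using this
  exact hconv.ordConnected.out hmem hs ⟨ht, (mem_Ioi.1 hs2).le⟩

theorem graph_mem_frontier 
    (hΩ : ∀ z t, ι z + t • v ∈ ball x r → (ι z + t • v ∈ Ω ↔ ψ z < t))
    (hopen : IsOpen Ω) {z : EuclideanSpace ℝ (Fin m)} 
    (hb : ι z + ψ z • v ∈ ball x r) : ι z + ψ z • v ∈ frontier Ω := by
  have hc : Continuous fun t : ℝ => ι z + t • v := by fun_prop
  rw [hopen.frontier_eq]
  refine ⟨?_, fun h => lt_irrefl _ ((hΩ _ _ hb).1 h)⟩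
  refine mem_closure_of_tendsto (b := nhdsWithin (ψ z) (Ioi (ψ z)))
    ((hc.tendsto (ψ z)).mono_left nhdsWithin_le_nhds) ?_
  filter_upwards [(hc.tendsto (ψ z)).mono_left nhdsWithin_le_nhds (isOpen_ball.mem_nhds hb),
    self_mem_nhdsWithin] with t ht1 ht2
  exact (hΩ _ _ ht1).2 ht2

/-- The part of the outer `ε`-collar of `Ω` inside `S`. -/
def outerCollar (S Ω : Set (EuclideanSpace ℝ (Fin n))) (ε : ℝ) : Set (EuclideanSpace ℝ (Fin n)) :=
  S ∩ (thickening ε Ω \ Ω)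

theorem measurableSet_outerCollar (hS : IsOpen S) (hΩ : IsOpen Ω) (ε : ℝ) :
    MeasurableSet (outerCollar S Ω ε) :=
  hS.measurableSet.inter (isOpen_thickening.measurableSet.diff hΩ.measurableSet)

end LocalGraph

section LocalLimit

open Filter Topology

variable {m : ℕ} {v : EuclideanSpace ℝ (Fin (m + 1))}
  {ι : EuclideanSpace ℝ (Fin m) →ₗᵢ[ℝ] EuclideanSpace ℝ (Fin (m + 1))}
  {ψ : EuclideanSpace ℝ (Fin m) → ℝ} {K : ℝ≥0} {x : EuclideanSpace ℝ (Fin (m + 1))} {r : ℝ}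
  {Ω S : Set (EuclideanSpace ℝ (Fin (m + 1)))}

theorem setLIntegral_eq_mul_lintegral_graph_coordinates
    (hmp : MeasurePreserving (fun p : EuclideanSpace ℝ (Fin m) × ℝ => ι p.1 + p.2 • v)
        (volume.prod volume) volume) (hψ : Continuous ψ) {ε : ℝ} (hε : 0 < ε)
    {f : EuclideanSpace ℝ (Fin (m + 1)) → ℝ≥0∞} (hf : Measurable f) :
    ∫⁻ y, f y = ENNReal.ofReal ε *
      ∫⁻ p : EuclideanSpace ℝ (Fin m) × ℝ, f (ι p.1 + (ψ p.1 - ε * p.2) • v) := by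
  have hι := ι.continuous
  have hc : Measurable fun p : EuclideanSpace ℝ (Fin m) × ℝ => ι p.1 + (ψ p.1 - ε * p.2) • v :=
    Continuous.measurable (by fun_prop)
  have hfm := hf.comp hmp.measurable
  have hfc := hf.comp hc
  simp only [Function.comp_def] at hfm hfc
  rw [← hmp.lintegral_comp hf, lintegral_prod _ hfm.aemeasurable,
    Measure.volume_eq_prod, lintegral_prod _ hfc.aemeasurable, ← lintegral_const_mul]
  · congr 1 with z
    exact lintegral_eq_mul_lintegral_comp_affine hε (ψ z)
      (hfm.comp (measurable_const.prodMk measurable_id))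
  · exact hfc.lintegral_prod_right'

theorem limsup_collar_le_of_chart (hv : ‖v‖ = 1) (hι : ∀ z, ⟪ι z, v⟫ = 0)
    (hsurj : ∀ y, ∃ z, ∃ t : ℝ, y = ι z + t • v)
    (hmp : MeasurePreserving (fun p : EuclideanSpace ℝ (Fin m) × ℝ => ι p.1 + p.2 • v)
        (volume.prod volume) volume)
    (hψ : LipschitzWith K ψ) (hr : 0 < r)
    (hΩ : ∀ z t, ι z + t • v ∈ ball x r → (ι z + t • v ∈ Ω ↔ ψ z < t))
    (hopen : IsOpen Ω) (hSo : IsOpen S) (hS : Convex ℝ S) (hΩS : Ω ⊆ S)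
    {f : EuclideanSpace ℝ (Fin (m + 1)) → ℝ≥0∞} (hf : Continuous f) {M : ℝ≥0} (hM : ∀ y, f y ≤ M)
    (hsupp : ∀ y, f y ≠ 0 → y ∈ ball x (r / 2))
    {ε : ℕ → ℝ} (hε : ∀ k, 0 < ε k) (hε0 : Tendsto ε atTop (𝓝 0)) :
    limsup (fun k => (ENNReal.ofReal (ε k))⁻¹ * ∫⁻ y in outerCollar S Ω (ε k), f y) atTop ≤
      ∫⁻ y in S ∩ frontier Ω, f y ∂μHE[m] := by
  have hιc := ι.continuous
  have hψc := hψ.continuous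
  obtain ⟨k₀, hk₀⟩ : ∃ k₀, ∀ k ≥ k₀, ε k ≤ r / 2 :=
    eventually_atTop.1 (hε0.eventually_le_const (by positivity))
  let c : ℝ → EuclideanSpace ℝ (Fin m) × ℝ → EuclideanSpace ℝ (Fin (m + 1)) :=
    fun ε p => ι p.1 + (ψ p.1 - ε * p.2) • v
  have hc : ∀ ε, Continuous (c ε) := fun ε => by fun_prop
  let Φ : ℕ → EuclideanSpace ℝ (Fin m) × ℝ → ℝ≥0∞ :=
    fun k p => (outerCollar S Ω (ε (k + k₀))).indicator f (c (ε (k + k₀)) p)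
  have hind : ∀ ε, Measurable ((outerCollar S Ω ε).indicator f) := fun ε =>
    hf.measurable.indicator (measurableSet_outerCollar hSo hopen ε)
  have hΦm : ∀ k, Measurable (Φ k) := fun k => (hind _).comp (hc _).measurable
  obtain ⟨zx, tx, hx⟩ := hsurj x
  -- what non-vanishing of the integrand says
  have hΦne : ∀ k p, Φ k p ≠ 0 → 0 ≤ p.2 ∧ c (ε (k + k₀)) p ∈ S ∧
      c (ε (k + k₀)) p ∈ ball x (r / 2) ∧
      ∃ z' t', ψ z' < t' ∧
        ‖ι (z' - p.1) + (t' - (ψ p.1 - ε (k + k₀) * p.2)) • v‖ < ε (k + k₀) := by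
    intro k p hp
    have hmem : c (ε (k + k₀)) p ∈ outerCollar S Ω (ε (k + k₀)) := by
      by_contra h
      exact hp (indicator_of_notMem h f)
    have hb : c (ε (k + k₀)) p ∈ ball x (r / 2) := by
      refine hsupp _ fun h => hp ?_
      simp only [Φ]
      rw [indicator_of_mem hmem, h]
    refine ⟨?_, hmem.1, hb, exists_close_point_above_graph hsurj hΩ (hk₀ _ (Nat.le_add_left _ _)) hb
      hmem.2.1⟩
    have h1 := mt (hΩ _ _ (ball_subset_ball (by linarith) hb)).2 hmem.2.2
    by_contra! hneg
    nlinarith [mul_neg_of_pos_of_neg (hε (k + k₀)) hneg]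
  have hτ : ∀ k p, Φ k p ≠ 0 → p.2 ≤ 1 + K := by
    intro k p hp
    obtain ⟨-, -, -, z', t', h1, h2⟩ := hΦne k p hp
    have := sub_le_of_close_point_above_graph hv hι hψ h1 h2
    rw [sub_sub_cancel] at this
    exact le_of_mul_le_mul_left this (hε _)
  let g : EuclideanSpace ℝ (Fin m) × ℝ → ℝ≥0∞ :=
    (ball zx (r / 2) ×ˢ Icc (0 : ℝ) (1 + K)).indicator fun _ => M
  have hg : ∀ k, Φ k ≤ g := by
    intro k p
    by_cases hp : Φ k p = 0
    · rw [hp]; exact zero_le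
    have h1 : p ∈ ball zx (r / 2) ×ˢ Icc (0 : ℝ) (1 + K) := by
      refine ⟨?_, (hΦne k p hp).1, hτ k p hp⟩
      have h2 := (hΦne k p hp).2.2.1
      rw [mem_ball, dist_eq_norm] at h2 ⊢
      refine lt_of_le_of_lt ?_ h2
      have h3 : c (ε (k + k₀)) p - x = ι (p.1 - zx) + (ψ p.1 - ε (k + k₀) * p.2 - tx) • v := by
        rw [hx, map_sub]; simp only [c]; module
      rw [h3]
      exact norm_le_norm_add_smul hv ι hι _ _
    simp only [g]
    rw [indicator_of_mem h1]
    exact (indicator_le_self _ _ _).trans (hM _)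
  have hgfin : ∫⁻ p, g p ≠ ∞ := by
    rw [lintegral_indicator (measurableSet_ball.prod measurableSet_Icc), setLIntegral_const,
      Measure.volume_eq_prod, Measure.prod_prod, Real.volume_Icc]
    exact ENNReal.mul_ne_top ENNReal.coe_ne_top
      (ENNReal.mul_ne_top measure_ball_lt_top.ne ENNReal.ofReal_ne_top)
  let A : Set (EuclideanSpace ℝ (Fin m)) := {z | ι z + ψ z • v ∈ S ∩ ball x r}
  have hA : MeasurableSet A :=
    ((hSo.inter isOpen_ball).preimage (continuous_graph ι hψc)).measurableSet
  have hlim : ∀ᵐ p : EuclideanSpace ℝ (Fin m) × ℝ, limsup (fun k => Φ k p) atTop ≤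
      (Icc 0 (graphJacobian (fderiv ℝ ψ p.1))).indicator
        (fun _ => A.indicator (fun z => f (ι z + ψ z • v)) p.1) p.2 := by
    have hdiff : ∀ᵐ p : EuclideanSpace ℝ (Fin m) × ℝ, DifferentiableAt ℝ ψ p.1 :=
      Measure.quasiMeasurePreserving_fst.ae hψ.ae_differentiableAt
    filter_upwards [hdiff] with p hp
    have hεk : Tendsto (fun k => ε (k + k₀)) atTop (𝓝 0) := (tendsto_add_atTop_iff_nat k₀).2 hε0
    by_cases hJ : p.2 ∈ Icc 0 (graphJacobian (fderiv ℝ ψ p.1))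
    swap
    · suffices h : ∀ᶠ k in atTop, Φ k p = 0 by
        rw [limsup_congr h]; simp
      rw [mem_Icc, not_and_or, not_le, not_le] at hJ
      rcases hJ with hJ | hJ
      · refine Eventually.of_forall fun k => ?_
        by_contra h
        exact absurd (hΦne k p h).1 (not_le.2 hJ)
      · obtain ⟨δ, hδ, h⟩ := sub_lt_of_close_point_above_graph hv hι hp hJ
        filter_upwards [hεk.eventually_le_const hδ] with k hk
        by_contra hne
        obtain ⟨-, -, -, z', t', h1, h2⟩ := hΦne k p hne
        have := h _ hk z' _ t' h1 h2
        rw [sub_sub_cancel] at this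
        exact lt_irrefl _ this
    rw [indicator_of_mem hJ]
    have hcl : Tendsto (fun k => c (ε (k + k₀)) p) atTop (𝓝 (ι p.1 + ψ p.1 • v)) := by
      have h1 : Continuous fun e : ℝ => c e p := by fun_prop
      have h2 := (h1.tendsto 0).comp hεk
      simpa [c, Function.comp_def] using h2
    by_cases hpA : p.1 ∈ A
    · rw [indicator_of_mem hpA, ← (((hf.tendsto _).comp hcl).limsup_eq)]
      exact limsup_le_limsup (Eventually.of_forall fun k => indicator_le_self _ _ _)
    · rw [indicator_of_notMem hpA]
      suffices h : ∀ᶠ k in atTop, Φ k p = 0 by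
        rw [limsup_congr h]; simp
      by_cases hb : ι p.1 + ψ p.1 • v ∈ ball x r
      · refine Eventually.of_forall fun k => ?_
        by_contra hne
        refine hpA ⟨graph_mem_of_below_mem hΩ hS hΩS ?_ hb (hΦne k p hne).2.1, hb⟩
        have := mul_nonneg (hε (k + k₀)).le hJ.1
        linarith
      · have hb' : ι p.1 + ψ p.1 • v ∈ (closedBall x (r / 2))ᶜ := fun h =>
          hb (closedBall_subset_ball (by linarith) h)
        filter_upwards [hcl (isClosed_closedBall.isOpen_compl.mem_nhds hb')] with k hk
        by_contra hne
        exact hk (ball_subset_closedBall (hΦne k p hne).2.2.1)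
  have hJm : Measurable fun z => graphJacobian (fderiv ℝ ψ z) :=
    continuous_graphJacobian.measurable.comp (measurable_fderiv ℝ ψ)
  have hfG : Measurable fun z => f (ι z + ψ z • v) :=
    (hf.comp (continuous_graph ι hψc)).measurable
  calc limsup (fun k => (ENNReal.ofReal (ε k))⁻¹ * ∫⁻ y in outerCollar S Ω (ε k), f y) atTop
      = limsup (fun k => ∫⁻ p, Φ k p) atTop := by
        rw [← limsup_nat_add _ k₀]
        congr 1 with k
        rw [← lintegral_indicator (measurableSet_outerCollar hSo hopen _),
          setLIntegral_eq_mul_lintegral_graph_coordinates hmp hψc (hε (k + k₀)) (hind _),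
          ← mul_assoc, ENNReal.inv_mul_cancel (by simpa using hε _) ENNReal.ofReal_ne_top, one_mul]
    _ ≤ ∫⁻ p, limsup (fun k => Φ k p) atTop :=
        limsup_lintegral_le g hΦm (fun k => Eventually.of_forall (hg k)) hgfin
    _ ≤ ∫⁻ p : EuclideanSpace ℝ (Fin m) × ℝ, (Icc 0 (graphJacobian (fderiv ℝ ψ p.1))).indicator
        (fun _ => A.indicator (fun z => f (ι z + ψ z • v)) p.1) p.2 := lintegral_mono_ae hlim
    _ ≤ ∫⁻ z, ∫⁻ τ, (Icc 0 (graphJacobian (fderiv ℝ ψ z))).indicator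
        (fun _ => A.indicator (fun z => f (ι z + ψ z • v)) z) τ :=
        lintegral_prod_le _
    _ = ∫⁻ z in A, ENNReal.ofReal (graphJacobian (fderiv ℝ ψ z)) * f (ι z + ψ z • v) := by
        rw [← lintegral_indicator hA]
        congr 1 with z
        rw [lintegral_indicator measurableSet_Icc, setLIntegral_const, Real.volume_Icc, sub_zero,
          mul_comm]
        by_cases hz : z ∈ A <;> simp [hz]
    _ ≤ ∫⁻ y in (fun z => ι z + ψ z • v) '' A, f y ∂μHE[m] :=
        lintegral_comp_graph_le hv ι hι hψ hA hf.measurable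
    _ ≤ ∫⁻ y in S ∩ frontier Ω, f y ∂μHE[m] := by
        refine lintegral_mono_set ?_
        rintro _ ⟨z, hz, rfl⟩
        exact ⟨hz.1, graph_mem_frontier hΩ hopen hz.2⟩

end LocalLimit

section

open Filter Topology

theorem IsLipschitzDomain.exists_graph_coordinates {m : ℕ}
    {Ω : Set (EuclideanSpace ℝ (Fin (m + 1)))} (hΩ : IsLipschitzDomain Ω)
    {x : EuclideanSpace ℝ (Fin (m + 1))} (hx : x ∈ frontier Ω) :
    ∃ r > (0 : ℝ), ∃ v : EuclideanSpace ℝ (Fin (m + 1)), ‖v‖ = 1 ∧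
      ∃ ι : EuclideanSpace ℝ (Fin m) →ₗᵢ[ℝ] EuclideanSpace ℝ (Fin (m + 1)), (∀ z, ⟪ι z, v⟫ = 0) ∧
        (∀ y, ∃ z, ∃ t : ℝ, y = ι z + t • v) ∧
        MeasurePreserving (fun p : EuclideanSpace ℝ (Fin m) × ℝ => ι p.1 + p.2 • v)
          (volume.prod volume) volume ∧
        ∃ (K : ℝ≥0) (ψ : EuclideanSpace ℝ (Fin m) → ℝ), LipschitzWith K ψ ∧
          ∀ z t, ι z + t • v ∈ ball x r → (ι z + t • v ∈ Ω ↔ ψ z < t) := by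
  obtain ⟨r, hr, v, hv, K, φ, hφ, hball⟩ := hΩ.2.2.2 x hx
  obtain ⟨ι, hι, hsurj, hmp⟩ := exists_orthogonal_chart hv
  refine ⟨r, hr, v, hv, ι, hι, fun y => ?_, hmp, K, fun z => φ (ι z), ?_, fun z t hb => ?_⟩
  · obtain ⟨z, hz⟩ := hsurj y
    exact ⟨z, _, hz⟩
  · exact (hφ.comp ι.lipschitz).weaken (mul_one K).le
  · have h1 : ⟪ι z + t • v, v⟫ = t := by
      rw [inner_add_left, hι, inner_smul_left, real_inner_self_eq_norm_sq, hv]; simp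
    rw [hball _ hb, h1, add_sub_cancel_right]

theorem exists_mem_frontier_dist_lt {E : Type*} [NormedAddCommGroup E] [NormedSpace ℝ E] {Ω : Set E}
    {ε : ℝ} {y : E} (hy : y ∈ thickening ε Ω) (hyΩ : y ∉ Ω) : y ∈ thickening ε (frontier Ω) := by
  obtain ⟨y', hy', hd⟩ := mem_thickening_iff.1 hy
  obtain ⟨p, hp, hpf⟩ : (segment ℝ y y' ∩ frontier Ω).Nonempty := by
    by_contra! h
    have hcover : segment ℝ y y' ⊆ interior Ω ∪ interior Ωᶜ := by
      rw [← compl_frontier_eq_union_interior]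
      exact fun p hp hpf => h.subset ⟨hp, hpf⟩
    obtain ⟨p, -, hp1, hp2⟩ := (convex_segment (𝕜 := ℝ) y y').isPreconnected _ _ isOpen_interior
      isOpen_interior hcover
      ⟨y', right_mem_segment ℝ _ _, (hcover (right_mem_segment ℝ _ _)).resolve_right
        fun h => interior_subset h hy'⟩
      ⟨y, left_mem_segment ℝ _ _, (hcover (left_mem_segment ℝ _ _)).resolve_left
        fun h => hyΩ (interior_subset h)⟩
    exact interior_subset hp2 (interior_subset hp1)
  refine mem_thickening_iff.2 ⟨p, hpf, lt_of_le_of_lt ?_ hd⟩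
  have := dist_add_dist_of_mem_segment hp
  linarith [dist_nonneg (x := p) (y := y')]

theorem IsLipschitzDomain.isCompact_frontier {n : ℕ} {Ω : Set (EuclideanSpace ℝ (Fin n))}
    (hΩ : IsLipschitzDomain Ω) : IsCompact (frontier Ω) :=
  (isCompact_of_isClosed_isBounded isClosed_closure hΩ.2.2.1.closure).of_isClosed_subset
    isClosed_frontier frontier_subset_closure

theorem IsLipschitzDomain.euclideanHausdorffMeasure_frontier_lt_top {m : ℕ}
    {Ω : Set (EuclideanSpace ℝ (Fin (m + 1)))} (hΩ : IsLipschitzDomain Ω) :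
    μHE[m] (frontier Ω) < ∞ := by
  refine hΩ.isCompact_frontier.measure_lt_top_of_nhdsWithin fun x hx => ?_
  obtain ⟨r, hr, v, hv, ι, hι, hsurj, -, K, ψ, hψ, hgraph⟩ := hΩ.exists_graph_coordinates hx
  obtain ⟨zx, tx, rfl⟩ := hsurj x
  refine ⟨frontier Ω ∩ ball (ι zx + tx • v) (r / 2),
    inter_mem_nhdsWithin _ (isOpen_ball.mem_nhds (mem_ball_self (half_pos hr))), ?_⟩
  have hsub : frontier Ω ∩ ball (ι zx + tx • v) (r / 2) ⊆
      (fun z => ι z + ψ z • v) '' ball zx (r / 2) := by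
    rintro y ⟨hyf, hyb⟩
    obtain ⟨z, t, rfl⟩ := hsurj y
    have hle : t ≤ ψ z := by
      rw [hΩ.1.frontier_eq] at hyf
      exact not_lt.1 fun h => hyf.2 ((hgraph z t (ball_subset_ball (by linarith) hyb)).2 h)
    have hge : ψ z ≤ t := by
      refine le_of_tendsto_of_tendsto (b := 𝓝[>] (0 : ℝ)) tendsto_const_nhds
        (f := fun _ => ψ z) (g := fun ε => t + ε * (1 + K)) ?_ ?_
      · have : Continuous fun ε : ℝ => t + ε * (1 + K) := by fun_prop
        simpa using (this.tendsto 0).mono_left nhdsWithin_le_nhds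
      · filter_upwards [Ioo_mem_nhdsGT (half_pos hr)] with ε hε
        obtain ⟨z', t', h1, h2⟩ := exists_close_point_above_graph hsurj hgraph hε.2.le hyb
          (closure_subset_thickening hε.1 _ (frontier_subset_closure hyf))
        linarith [sub_le_of_close_point_above_graph hv hι hψ h1 h2]
    obtain rfl := hle.antisymm hge
    refine ⟨z, ?_, rfl⟩
    rw [mem_ball, dist_eq_norm] at hyb ⊢
    have heq : ι z + ψ z • v - (ι zx + tx • v) = ι (z - zx) + (ψ z - tx) • v := by
      rw [map_sub]; module
    rw [heq] at hyb
    exact (norm_le_norm_add_smul hv ι hι _ _).trans_lt hyb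
  have hG : LipschitzWith (1 + K) (fun z => ι z + ψ z • v) := by
    refine ι.lipschitz.add ?_
    refine LipschitzWith.of_dist_le_mul fun a b => ?_
    rw [dist_eq_norm, ← sub_smul, norm_smul, hv, mul_one, ← dist_eq_norm]
    exact hψ.dist_le_mul a b
  calc μHE[m] (frontier Ω ∩ ball (ι zx + tx • v) (r / 2))
      ≤ μHE[m] ((fun z => ι z + ψ z • v) '' ball zx (r / 2)) := measure_mono hsub
    _ ≤ ((1 + K : ℝ≥0) : ℝ≥0∞) ^ m * μHE[m] (ball zx (r / 2)) :=
        hG.lipschitzOnWith.euclideanHausdorffMeasure_image_le m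
    _ < ∞ := by
        rw [EuclideanSpace.euclideanHausdorffMeasure_eq_volume]
        exact ENNReal.mul_lt_top (by finiteness) measure_ball_lt_top

theorem ENNReal.limsup_sum_le {β : Type*} (T : Finset β) (u : β → ℕ → ℝ≥0∞) :
    limsup (fun k => ∑ i ∈ T, u i k) atTop ≤ ∑ i ∈ T, limsup (u i) atTop := by
  classical
  have hadd : ∀ u v : ℕ → ℝ≥0∞,
      limsup (fun k => u k + v k) atTop ≤ limsup u atTop + limsup v atTop := by
    intro u v
    refine le_of_forall_gt fun c hc => ?_
    obtain ⟨a, ha, b, hb, hab⟩ : ∃ a > limsup u atTop, ∃ b > limsup v atTop, a + b < c := by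
      have h1 := hc.ne_top
      rw [ENNReal.add_ne_top] at h1
      have hcont : Tendsto (fun d : ℝ≥0∞ => (limsup u atTop + d) + (limsup v atTop + d)) (𝓝[>] 0)
          (𝓝 ((limsup u atTop + 0) + (limsup v atTop + 0))) := by
        refine Tendsto.mono_left ?_ nhdsWithin_le_nhds
        exact (tendsto_const_nhds.add tendsto_id).add (tendsto_const_nhds.add tendsto_id)
      rw [add_zero, add_zero] at hcont
      obtain ⟨d, hd1, hd2⟩ := ((hcont.eventually_lt_const hc).and self_mem_nhdsWithin).exists
      exact ⟨_, ENNReal.lt_add_right h1.1 (ne_of_gt hd2), _,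
        ENNReal.lt_add_right h1.2 (ne_of_gt hd2), hd1⟩
    refine lt_of_le_of_lt (limsup_le_of_le (h := ?_)) hab
    filter_upwards [eventually_lt_of_limsup_lt ha, eventually_lt_of_limsup_lt hb] with k h1 h2
    exact (ENNReal.add_lt_add h1 h2).le
  induction T using Finset.induction_on with
  | empty => simp
  | insert i T hi ih =>
    simp only [Finset.sum_insert hi]
    exact (hadd _ _).trans (add_le_add le_rfl ih)

/-- The outer Minkowski content inside `S` is at most the perimeter inside `S`. -/
theorem IsLipschitzDomain.limsup_collar_le {m : ℕ} {S Ω : Set (EuclideanSpace ℝ (Fin (m + 1)))}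
    (hΩ : IsLipschitzDomain Ω) (hSo : IsOpen S) (hS : Convex ℝ S) (hΩS : Ω ⊆ S)
    {W : EuclideanSpace ℝ (Fin (m + 1)) → ℝ≥0} (hW : Continuous W)
    {ε : ℕ → ℝ} (hε : ∀ k, 0 < ε k) (hε0 : Tendsto ε atTop (𝓝 0)) :
    limsup (fun k => (ENNReal.ofReal (ε k))⁻¹ * ∫⁻ y in outerCollar S Ω (ε k), W y) atTop ≤
      ∫⁻ y in S ∩ frontier Ω, W y ∂μHE[m] := by
  have hcpt := hΩ.isCompact_frontier
  choose! r hr hchart using fun x hx => hΩ.exists_graph_coordinates (x := x) hx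
  obtain ⟨T, hT⟩ := hcpt.elim_nhds_subcover' (fun x _ => ball x (r x / 2)) fun x hx =>
    ball_mem_nhds x (half_pos (hr x hx))
  let g : frontier Ω → EuclideanSpace ℝ (Fin (m + 1)) → ℝ≥0 :=
    fun x y => Real.toNNReal (r x / 2 - dist y x)
  have hg : ∀ x, Continuous (g x) := fun x => by fun_prop
  let G : EuclideanSpace ℝ (Fin (m + 1)) → ℝ≥0 := fun y => ∑ x ∈ T, g x y
  have hG : Continuous G := by fun_prop
  have hGpos : ∀ y ∈ frontier Ω, 0 < G y := by
    intro y hy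
    obtain ⟨x, hx, hyx⟩ := mem_iUnion₂.1 (hT hy)
    refine Finset.sum_pos_iff.2 ⟨x, hx, ?_⟩
    simpa [g] using hyx
  obtain ⟨δ, hδ, hδG⟩ : ∃ δ > 0, ∀ y ∈ frontier Ω, δ < G y := by
    rcases (frontier Ω).eq_empty_or_nonempty with h | h
    · exact ⟨1, one_pos, by simp [h]⟩
    · obtain ⟨y, hy, hmin⟩ := hcpt.exists_isMinOn h hG.continuousOn
      obtain ⟨δ, hδ, hδy⟩ := exists_between (hGpos y hy)
      exact ⟨δ, hδ, fun z hz => hδy.trans_le (hmin hz)⟩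
  obtain ⟨ε₀, hε₀, hthick⟩ := hcpt.exists_thickening_subset_open
    (isOpen_lt continuous_const hG : IsOpen {y | δ < G y}) hδG
  let f : frontier Ω → EuclideanSpace ℝ (Fin (m + 1)) → ℝ≥0 :=
    fun x y => g x y / max (G y) δ * W y
  have hf : ∀ x, Continuous (f x) := fun x =>
    (((hg x).div₀ (hG.max continuous_const) fun y => (hδ.trans_le (le_max_right _ _)).ne')).mul hW
  have hfsum : ∀ y, ∑ x ∈ T, f x y = G y / max (G y) δ * W y := fun y => by
    rw [← Finset.sum_mul, ← Finset.sum_div]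
  have hsum_le : ∀ y, ∑ x ∈ T, f x y ≤ W y := fun y => by
    rw [hfsum]
    exact mul_le_of_le_one_left zero_le (div_le_one_of_le₀ (le_max_left _ _) zero_le)
  have hsum_eq : ∀ ε ≤ ε₀, ∀ y ∈ outerCollar S Ω ε, W y = ∑ x ∈ T, f x y := by
    intro ε hε y hy
    have h1 : δ < G y := hthick (thickening_mono hε _ (exists_mem_frontier_dist_lt hy.2.1 hy.2.2))
    rw [hfsum, max_eq_left h1.le, div_self (hδ.trans h1).ne', one_mul]
  have hlocal : ∀ x : frontier Ω,
      limsup (fun k => (ENNReal.ofReal (ε k))⁻¹ * ∫⁻ y in outerCollar S Ω (ε k), f x y) atTop ≤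
        ∫⁻ y in S ∩ frontier Ω, f x y ∂μHE[m] := by
    intro x
    obtain ⟨v, hv, ι, hι, hsurj, hmp, K, ψ, hψ, hgraph⟩ := hchart x x.2
    have hsupp : ∀ y, f x y ≠ 0 → y ∈ ball (x : EuclideanSpace ℝ (Fin (m + 1))) (r x / 2) := by
      intro y hy
      have : g x y ≠ 0 := fun h => hy (by simp [f, h])
      simpa [g] using this
    obtain ⟨M, hM⟩ := (isCompact_closedBall (x : EuclideanSpace ℝ (Fin (m + 1)))
      (r x / 2)).bddAbove_image (hf x).continuousOn
    refine limsup_collar_le_of_chart (M := M) (f := fun y => f x y) hv hι hsurj hmp hψ (hr x x.2)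
      hgraph hΩ.1 hSo hS hΩS (ENNReal.continuous_coe.comp (hf x)) (fun y => ?_) (fun y hy => ?_)
      hε hε0
    · rw [ENNReal.coe_le_coe]
      by_cases hy : f x y = 0
      · rw [hy]; exact zero_le
      · exact hM ⟨y, ball_subset_closedBall (hsupp y hy), rfl⟩
    · exact hsupp y (by simpa using hy)
  have hfm : ∀ x, Measurable fun y => (f x y : ℝ≥0∞) := fun x =>
    (hf x).measurable.coe_nnreal_ennreal
  calc limsup (fun k => (ENNReal.ofReal (ε k))⁻¹ * ∫⁻ y in outerCollar S Ω (ε k), W y) atTop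
      = limsup (fun k => ∑ x ∈ T,
          (ENNReal.ofReal (ε k))⁻¹ * ∫⁻ y in outerCollar S Ω (ε k), f x y) atTop := by
        refine limsup_congr ?_
        filter_upwards [hε0.eventually_le_const hε₀] with k hk
        rw [← Finset.mul_sum, ← lintegral_finsetSum _ fun x _ => hfm x]
        congr 1
        refine setLIntegral_congr_fun (measurableSet_outerCollar hSo hΩ.1 _) fun y hy => ?_
        simp only [hsum_eq _ hk y hy, ENNReal.ofNNReal_finsetSum]
    _ ≤ ∑ x ∈ T, limsup (fun k =>
          (ENNReal.ofReal (ε k))⁻¹ * ∫⁻ y in outerCollar S Ω (ε k), f x y) atTop :=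
        ENNReal.limsup_sum_le T _
    _ ≤ ∑ x ∈ T, ∫⁻ y in S ∩ frontier Ω, f x y ∂μHE[m] := Finset.sum_le_sum fun x _ => hlocal x
    _ = ∫⁻ y in S ∩ frontier Ω, ((∑ x ∈ T, f x y : ℝ≥0) : ℝ≥0∞) ∂μHE[m] := by
        rw [← lintegral_finsetSum _ fun x _ => hfm x]
        simp only [ENNReal.ofNNReal_finsetSum]
    _ ≤ ∫⁻ y in S ∩ frontier Ω, W y ∂μHE[m] :=
        lintegral_mono fun y => ENNReal.coe_le_coe.2 (hsum_le y)

theorem setLIntegral_Ioo_rpow {c q : ℝ} (hc : 0 ≤ c) (hq : 0 ≤ q) :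
    ∫⁻ t in Ioo 0 c, ENNReal.ofReal (t ^ q) = ENNReal.ofReal (c ^ (q + 1) / (q + 1)) := by
  have hint : IntervalIntegrable (fun t : ℝ => t ^ q) volume 0 c :=
    intervalIntegral.intervalIntegrable_rpow (Or.inl hq)
  rw [intervalIntegrable_iff_integrableOn_Ioo_of_le hc] at hint
  rw [← ofReal_integral_eq_lintegral_ofReal hint, ← integral_Ioc_eq_integral_Ioo,
    ← intervalIntegral.integral_of_le hc, integral_rpow (Or.inl (by linarith)),
    Real.zero_rpow (by linarith), sub_zero]
  exact (ae_restrict_mem measurableSet_Ioo).mono fun t ht => Real.rpow_nonneg ht.1.le q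

theorem norm_inv_norm_smul_sub_le {E : Type*} [NormedAddCommGroup E] [InnerProductSpace ℝ E]
    {x y : E} (hx : 1 ≤ ‖x‖) (hy : 1 ≤ ‖y‖) : ‖‖x‖⁻¹ • x - ‖y‖⁻¹ • y‖ ≤ ‖x - y‖ := by
  have hx0 : 0 < ‖x‖ := by linarith
  have hy0 : 0 < ‖y‖ := by linarith
  refine le_of_sq_le_sq ?_ (norm_nonneg _)
  rw [norm_sub_sq_real, norm_sub_sq_real, norm_smul, norm_smul, inner_smul_left, inner_smul_right,
    norm_inv, norm_inv, norm_norm, norm_norm, inv_mul_cancel₀ hx0.ne', inv_mul_cancel₀ hy0.ne']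
  obtain ⟨s, hs⟩ : ∃ s, ⟪x, y⟫ = ‖x‖ * ‖y‖ * s := ⟨⟪x, y⟫ / (‖x‖ * ‖y‖), by field_simp⟩
  have hs1 : s ≤ 1 := by
    have := real_inner_le_norm x y
    rw [hs] at this
    exact le_of_mul_le_mul_left (by linarith) (mul_pos hx0 hy0)
  have hred : ‖x‖⁻¹ * (‖y‖⁻¹ * (‖x‖ * ‖y‖ * s)) = s := by field_simp
  simp only [conj_trivial]
  rw [hs, hred]
  nlinarith [sq_nonneg (‖x‖ - ‖y‖), mul_nonneg (sub_nonneg.2 (one_le_mul_of_one_le_of_one_le hx hy))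
    (sub_nonneg.2 hs1)]

section Cap

variable {m : ℕ} {p : EuclideanSpace ℝ (Fin (m + 1))}
  {ι : EuclideanSpace ℝ (Fin m) →ₗᵢ[ℝ] EuclideanSpace ℝ (Fin (m + 1))}

open scoped Pointwise in
/-- The volume of a truncated cone over a subset of an affine hyperplane. -/
theorem volume_cone_le
    (hmp : MeasurePreserving (fun q : EuclideanSpace ℝ (Fin m) × ℝ => ι q.1 + q.2 • p)
      (volume.prod volume) volume)
    {B : Set (EuclideanSpace ℝ (Fin m))} (hB : MeasurableSet B) {c : ℝ} (hc : 0 < c) :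
    ENNReal.ofReal (c ^ (m + 1) / (m + 1)) * volume B ≤
      volume (Ioo 0 c • ((fun z => ι z + p) '' B)) := by
  set T := Ioo 0 c • ((fun z => ι z + p) '' B)
  let Q : Set (EuclideanSpace ℝ (Fin m) × ℝ) := {q | q.2 ∈ Ioo 0 c ∧ q.2⁻¹ • q.1 ∈ B}
  have hQ : MeasurableSet Q := by
    have h : Measurable fun q : EuclideanSpace ℝ (Fin m) × ℝ => q.2⁻¹ • q.1 := by fun_prop
    exact (measurable_snd measurableSet_Ioo).inter (h hB)
  calc ENNReal.ofReal (c ^ (m + 1) / (m + 1)) * volume B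
      = ∫⁻ t in Ioo 0 c, ENNReal.ofReal (t ^ (m : ℝ)) * volume B := by
        rw [lintegral_mul_const _ (by fun_prop), setLIntegral_Ioo_rpow hc.le (Nat.cast_nonneg m)]
        norm_cast
    _ = ∫⁻ t in Ioo 0 c, volume ((fun z => (z, t)) ⁻¹' Q) := by
        refine setLIntegral_congr_fun measurableSet_Ioo fun t ht => ?_
        have h1 : (fun z : EuclideanSpace ℝ (Fin m) => (z, t)) ⁻¹' Q = (fun z => t⁻¹ • z) ⁻¹' B := by
          ext z; simp [Q, ht.1, ht.2]
        simp only [h1]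
        rw [Measure.addHaar_preimage_smul _ (inv_ne_zero ht.1.ne'), finrank_euclideanSpace_fin,
          Real.rpow_natCast, inv_pow, inv_inv, abs_of_pos (pow_pos ht.1 m)]
    _ ≤ ∫⁻ t, volume ((fun z => (z, t)) ⁻¹' Q) := setLIntegral_le_lintegral _ _
    _ = (volume.prod volume) Q := (Measure.prod_apply_symm hQ).symm
    _ ≤ (volume.prod volume) ((fun q : EuclideanSpace ℝ (Fin m) × ℝ => ι q.1 + q.2 • p) ⁻¹' T) := by
        refine measure_mono ?_
        rintro ⟨z, t⟩ ⟨ht, hz⟩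
        refine ⟨t, ht, _, ⟨_, hz, rfl⟩, ?_⟩
        simp [smul_add, smul_smul, mul_inv_cancel₀ ht.1.ne']
    _ ≤ Measure.map (fun q : EuclideanSpace ℝ (Fin m) × ℝ => ι q.1 + q.2 • p)
          (volume.prod volume) T := Measure.le_map_apply hmp.measurable.aemeasurable _
    _ = volume T := by rw [hmp.map_eq]

open scoped Pointwise in
theorem euclideanHausdorffMeasure_cap_le (hp : ‖p‖ = 1) {A : Set (EuclideanSpace ℝ (Fin (m + 1)))}
    (hA : MeasurableSet A) (hAs : A ⊆ sphere 0 1) {c : ℝ} (hc : 0 < c) (hAc : ∀ x ∈ A, c < ⟪x, p⟫) :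
    ENNReal.ofReal (c ^ (m + 1)) * μHE[m] A ≤
      ((m + 1 : ℕ) : ℝ≥0∞) * volume (Ioo (0 : ℝ) 1 • A) := by
  obtain ⟨ι, hι, hsurj, hmp⟩ := exists_orthogonal_chart hp
  have hιc := ι.continuous
  have h1 : ∀ z, 1 ≤ ‖ι z + p‖ := fun z => by
    have h := norm_add_smul_sq hp ι hι z 1
    rw [one_smul] at h
    nlinarith [norm_nonneg (ι z + p), sq_nonneg ‖z‖]
  let N : EuclideanSpace ℝ (Fin m) → EuclideanSpace ℝ (Fin (m + 1)) :=
    fun z => ‖ι z + p‖⁻¹ • (ι z + p)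
  have hN : LipschitzWith 1 N := LipschitzWith.of_dist_le_mul fun z z' => by
    rw [dist_eq_norm, dist_eq_norm, NNReal.coe_one, one_mul, ← ι.norm_map, map_sub]
    refine (norm_inv_norm_smul_sub_le (h1 z) (h1 z')).trans_eq ?_
    congr 1; abel
  have hNp : ∀ z, ⟪N z, p⟫ = ‖ι z + p‖⁻¹ := fun z => by
    simp only [N]
    rw [inner_smul_left, inner_add_left, hι, real_inner_self_eq_norm_sq, hp]; simp
  have hB : MeasurableSet (N ⁻¹' A) := hN.continuous.measurable hA
  have hAN : A ⊆ N '' (N ⁻¹' A) := by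
    intro x hx
    obtain ⟨z, hz⟩ := hsurj x
    have hs : 0 < ⟪x, p⟫ := hc.trans (hAc x hx)
    set s := ⟪x, p⟫
    have hxn : ‖x‖ = 1 := by simpa using hAs hx
    have hx' : x = s • (ι (s⁻¹ • z) + p) := by
      rw [smul_add, map_smul, smul_smul, mul_inv_cancel₀ hs.ne', one_smul, ← hz]
    have hsn : s = ‖ι (s⁻¹ • z) + p‖⁻¹ := by
      have h2 := hxn
      rw [hx', norm_smul, Real.norm_of_nonneg hs.le] at h2
      exact eq_inv_of_mul_eq_one_left h2
    have hNx : N (s⁻¹ • z) = x := by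
      simp only [N]; rw [← hsn, ← hx']
    exact ⟨s⁻¹ • z, by rwa [mem_preimage, hNx], hNx⟩
  have hvol : μHE[m] A ≤ volume (N ⁻¹' A) := by
    calc μHE[m] A ≤ μHE[m] (N '' (N ⁻¹' A)) := measure_mono hAN
      _ ≤ ((1 : ℝ≥0) : ℝ≥0∞) ^ m * μHE[m] (N ⁻¹' A) :=
          hN.lipschitzOnWith.euclideanHausdorffMeasure_image_le m
      _ = volume (N ⁻¹' A) := by
          rw [EuclideanSpace.euclideanHausdorffMeasure_eq_volume]; simp
  have hcone : Ioo 0 c • ((fun z => ι z + p) '' (N ⁻¹' A)) ⊆ Ioo (0 : ℝ) 1 • A := by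
    rintro _ ⟨s, hs, _, ⟨z, hz, rfl⟩, rfl⟩
    have hpos : 0 < ‖ι z + p‖ := by linarith [h1 z]
    have h2 := hAc _ hz
    rw [hNp, lt_inv_comm₀ hc hpos] at h2
    refine ⟨s * ‖ι z + p‖, ⟨mul_pos hs.1 hpos, ?_⟩, N z, hz, ?_⟩
    · calc s * ‖ι z + p‖ < c * c⁻¹ := mul_lt_mul hs.2 h2.le hpos hc.le
        _ = 1 := mul_inv_cancel₀ hc.ne'
    · simp only [N]
      rw [smul_smul, mul_assoc, mul_inv_cancel₀ hpos.ne', mul_one]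
  calc ENNReal.ofReal (c ^ (m + 1)) * μHE[m] A
      ≤ ENNReal.ofReal (c ^ (m + 1)) * volume (N ⁻¹' A) := by gcongr
    _ = ((m + 1 : ℕ) : ℝ≥0∞) * (ENNReal.ofReal (c ^ (m + 1) / (m + 1)) * volume (N ⁻¹' A)) := by
        rw [← mul_assoc, ← ENNReal.ofReal_natCast, ← ENNReal.ofReal_mul (Nat.cast_nonneg _)]
        congr 2
        push_cast
        field_simp
    _ ≤ ((m + 1 : ℕ) : ℝ≥0∞) * volume (Ioo (0 : ℝ) 1 • A) := by
        gcongr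
        exact (volume_cone_le hmp hB hc).trans (measure_mono hcone)

end Cap

open scoped Pointwise in
/-- Hausdorff measure on the unit sphere is at most the spherical measure `Measure.toSphere`. -/
theorem comap_euclideanHausdorffMeasure_le_toSphere (m : ℕ) :
    (μHE[m]).comap ((↑) : sphere (0 : EuclideanSpace ℝ (Fin (m + 1))) 1 → EuclideanSpace ℝ (Fin (m + 1))) ≤
      (volume : Measure (EuclideanSpace ℝ (Fin (m + 1)))).toSphere := by
  have hemb : MeasurableEmbedding ((↑) : sphere (0 : EuclideanSpace ℝ (Fin (m + 1))) 1 → EuclideanSpace ℝ (Fin (m + 1))) :=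
    MeasurableEmbedding.subtype_coe isClosed_sphere.measurableSet
  have key : ∀ c : ℝ, 0 < c → c < 1 →
      ENNReal.ofReal (c ^ (m + 1)) • 
        (μHE[m]).comap ((↑) : sphere (0 : EuclideanSpace ℝ (Fin (m + 1))) 1 → EuclideanSpace ℝ (Fin (m + 1))) ≤
      (volume : Measure (EuclideanSpace ℝ (Fin (m + 1)))).toSphere := by
    intro c hc hc1
    have hne : Nonempty (sphere (0 : EuclideanSpace ℝ (Fin (m + 1))) 1) :=
      (NormedSpace.sphere_nonempty.2 zero_le_one).to_subtype
    let q := TopologicalSpace.denseSeq (sphere (0 : EuclideanSpace ℝ (Fin (m + 1))) 1)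
    let C : ℕ → Set (sphere (0 : EuclideanSpace ℝ (Fin (m + 1))) 1) :=
      disjointed fun i => {x | c < ⟪(x : EuclideanSpace ℝ (Fin (m + 1))), q i⟫}
    have hC : ∀ i, MeasurableSet (C i) := MeasurableSet.disjointed fun i =>
      (isOpen_lt continuous_const (by fun_prop)).measurableSet
    have hcover : ⋃ i, C i = univ := by
      rw [iUnion_disjointed, iUnion_eq_univ_iff]
      intro x
      have hopen : IsOpen {y : sphere (0 : EuclideanSpace ℝ (Fin (m + 1))) 1 |
          c < ⟪(x : EuclideanSpace ℝ (Fin (m + 1))), y⟫} :=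
        isOpen_lt continuous_const (by fun_prop)
      exact (TopologicalSpace.denseRange_denseSeq _).exists_mem_open hopen
        ⟨x, by simpa [real_inner_self_eq_norm_sq] using hc1⟩
    have hdisj : Pairwise (Function.onFun Disjoint C) := disjoint_disjointed _
    refine Measure.le_iff.2 fun s hs => ?_
    have hdec : s = ⋃ i, s ∩ C i := by rw [← inter_iUnion, hcover, inter_univ]
    rw [hdec, measure_iUnion, measure_iUnion]
    rotate_left
    iterate 2
      · exact fun i j hij => (hdisj hij).mono inter_subset_right inter_subset_right
      · exact fun i => hs.inter (hC i)
    refine ENNReal.tsum_le_tsum fun i => ?_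
    rw [Measure.toSphere_apply' _ (hs.inter (hC i)), Measure.smul_apply, hemb.comap_apply,
      finrank_euclideanSpace_fin, smul_eq_mul]
    refine euclideanHausdorffMeasure_cap_le (p := q i) (by simp)
      (hemb.measurableSet_image.2 (hs.inter (hC i))) ?_ hc ?_
    · rintro _ ⟨x, -, rfl⟩
      exact x.2
    · rintro _ ⟨x, hx, rfl⟩
      exact disjointed_subset
        (fun i => {x : sphere (0 : EuclideanSpace ℝ (Fin (m + 1))) 1 | c < ⟪x.1, (q i).1⟫}) i hx.2
  refine Measure.le_iff.2 fun s hs => ?_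
  have hlim : Tendsto (fun c : ℝ => ENNReal.ofReal (c ^ (m + 1)) *
      (μHE[m]).comap ((↑) : sphere (0 : EuclideanSpace ℝ (Fin (m + 1))) 1 → EuclideanSpace ℝ (Fin (m + 1))) s) (𝓝[<] 1)
      (𝓝 (1 * (μHE[m]).comap ((↑) : sphere (0 : EuclideanSpace ℝ (Fin (m + 1))) 1 → EuclideanSpace ℝ (Fin (m + 1))) s)) := by
    refine ENNReal.Tendsto.mul_const ?_ (Or.inl one_ne_zero)
    have h : Continuous fun c : ℝ => ENNReal.ofReal (c ^ (m + 1)) :=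
      ENNReal.continuous_ofReal.comp (continuous_pow _)
    simpa using (h.tendsto 1).mono_left nhdsWithin_le_nhds
  rw [one_mul] at hlim
  refine le_of_tendsto hlim ?_
  filter_upwards [Ioo_mem_nhdsLT (zero_lt_one (α := ℝ))] with c hc
  exact Measure.le_iff.1 (key c hc.1 hc.2) s hs

/-- The weighted perimeter of the unit ball in a cone, for a homogeneous weight. -/
theorem setLIntegral_sphere_le {m : ℕ} {S : Set (EuclideanSpace ℝ (Fin (m + 1)))}
    (hS : MeasurableSet S) (hScone : ∀ x ∈ S, ∀ t : ℝ, 0 < t → t • x ∈ S)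
    {ω : EuclideanSpace ℝ (Fin (m + 1)) → ℝ≥0∞} (hω : Measurable ω) {α : ℝ} (hα : 0 ≤ α)
    (hhom : ∀ x ∈ S, ∀ t : ℝ, 0 < t → ω (t • x) = ENNReal.ofReal (t ^ α) * ω x) :
    ∫⁻ x in S ∩ sphere 0 1, ω x ∂μHE[m] ≤
      ENNReal.ofReal (m + α + 1) * ∫⁻ x in S ∩ ball 0 1, ω x := by
  let σ := (volume : Measure (EuclideanSpace ℝ (Fin (m + 1)))).toSphere
  let h := (S ∩ ball 0 1).indicator ω
  have hh : Measurable h := hω.indicator (hS.inter measurableSet_ball)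
  have hq : (0 : ℝ) < m + α + 1 := by positivity
  have hradial : ∀ θ : sphere (0 : EuclideanSpace ℝ (Fin (m + 1))) 1,
      ∫⁻ r : Ioi (0 : ℝ), h (r.1 • θ.1) ∂(Measure.volumeIoiPow m) =
        ENNReal.ofReal (1 / (m + α + 1)) * S.indicator ω θ := by
    intro θ
    have hm1 : Measurable fun r : ℝ => ENNReal.ofReal (r ^ m) * h (r • θ.1) := by fun_prop
    have hm2 : Measurable fun r : Ioi (0 : ℝ) => h (r.1 • θ.1) := by fun_prop
    have hm3 : Measurable fun r : Ioi (0 : ℝ) => ENNReal.ofReal (r.1 ^ m) := by fun_prop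
    have hhθ : ∀ r ∈ Ioi (0 : ℝ), ENNReal.ofReal (r ^ m) * h (r • θ.1) =
        (Ioo 0 1).indicator (fun r => ENNReal.ofReal (r ^ ((m : ℝ) + α))) r * S.indicator ω θ := by
      intro r hr
      have hr0 : 0 < r := hr
      have hSr : r • θ.1 ∈ S ↔ θ.1 ∈ S := ⟨fun h => by
        simpa [smul_smul, inv_mul_cancel₀ hr0.ne'] using hScone _ h r⁻¹ (inv_pos.2 hr0),
        fun h => hScone _ h r hr0⟩
      have hbr : r • θ.1 ∈ ball (0 : EuclideanSpace ℝ (Fin (m + 1))) 1 ↔ r < 1 := by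
        rw [mem_ball_zero_iff, norm_smul, norm_eq_of_mem_sphere, mul_one, Real.norm_of_nonneg hr0.le]
      by_cases h1 : θ.1 ∈ S
      · by_cases h2 : r < 1
        · have h3 : r • θ.1 ∈ S ∩ ball 0 1 := ⟨hSr.2 h1, hbr.2 h2⟩
          simp only [h]
          rw [indicator_of_mem h3, indicator_of_mem h1, indicator_of_mem (show r ∈ Ioo (0 : ℝ) 1 from ⟨hr0, h2⟩),
            hhom _ h1 r hr0, ← mul_assoc, ← ENNReal.ofReal_mul (by positivity), Real.rpow_add hr0,
            Real.rpow_natCast]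
        · have h3 : r • θ.1 ∉ S ∩ ball 0 1 := fun h => h2 (hbr.1 h.2)
          simp only [h]
          rw [indicator_of_notMem h3, indicator_of_notMem (fun h => h2 h.2)]
          simp
      · have h3 : r • θ.1 ∉ S ∩ ball 0 1 := fun h => h1 (hSr.1 h.1)
        simp only [h]
        rw [indicator_of_notMem h3, indicator_of_notMem h1]
        simp
    calc ∫⁻ r : Ioi (0 : ℝ), h (r.1 • θ.1) ∂(Measure.volumeIoiPow m)
        = ∫⁻ r : Ioi (0 : ℝ), ENNReal.ofReal (r.1 ^ m) * h (r.1 • θ.1)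
            ∂(Measure.comap Subtype.val volume) :=
          lintegral_withDensity_eq_lintegral_mul _ hm3 hm2
      _ = ∫⁻ r in Ioi (0 : ℝ), ENNReal.ofReal (r ^ m) * h (r • θ.1) :=
          lintegral_subtype_comap measurableSet_Ioi fun r => ENNReal.ofReal (r ^ m) * h (r • θ.1)
      _ = ∫⁻ r in Ioi (0 : ℝ),
            (Ioo 0 1).indicator (fun r => ENNReal.ofReal (r ^ ((m : ℝ) + α))) r *
              S.indicator ω θ := setLIntegral_congr_fun measurableSet_Ioi hhθ
      _ = ENNReal.ofReal (1 / (m + α + 1)) * S.indicator ω θ := by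
          rw [lintegral_mul_const, setLIntegral_indicator measurableSet_Ioo,
            inter_eq_self_of_subset_left Ioo_subset_Ioi_self,
            setLIntegral_Ioo_rpow zero_le_one (by positivity), Real.one_rpow]
          exact Measurable.indicator (by fun_prop) measurableSet_Ioo
  have hpolar : ∫⁻ x in ({0}ᶜ : Set (EuclideanSpace ℝ (Fin (m + 1)))), h x =
      ENNReal.ofReal (1 / (m + α + 1)) * ∫⁻ θ, S.indicator ω θ ∂σ := by
    rw [← lintegral_subtype_comap (measurableSet_singleton _).compl]
    have hmp := (volume : Measure (EuclideanSpace ℝ (Fin (m + 1)))).measurePreserving_homeomorphUnitSphereProd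
    have hm : Measurable fun q : sphere (0 : EuclideanSpace ℝ (Fin (m + 1))) 1 × Ioi (0 : ℝ) =>
        h (q.2.1 • q.1.1) := by
      have : Measurable fun q : sphere (0 : EuclideanSpace ℝ (Fin (m + 1))) 1 × Ioi (0 : ℝ) =>
        q.2.1 • q.1.1 := Continuous.measurable (by fun_prop)
      exact hh.comp this
    have h1 := hmp.lintegral_comp hm
    rw [finrank_euclideanSpace_fin, Nat.add_sub_cancel] at h1
    calc _ = _ := lintegral_congr fun x => by
            congr 1
            exact congrArg Subtype.val ((homeomorphUnitSphereProd _).symm_apply_apply x).symm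
      _ = _ := h1
      _ = ∫⁻ θ, ∫⁻ r : Ioi (0 : ℝ), h (r.1 • θ.1) ∂(Measure.volumeIoiPow m) ∂σ :=
          lintegral_prod _ hm.aemeasurable
      _ = _ := by
          simp only [hradial]
          exact lintegral_const_mul _ ((hω.indicator hS).comp measurable_subtype_coe)
  calc ∫⁻ x in S ∩ sphere 0 1, ω x ∂μHE[m]
      = ∫⁻ x in sphere (0 : EuclideanSpace ℝ (Fin (m + 1))) 1, S.indicator ω x ∂μHE[m] := by
        rw [setLIntegral_indicator hS]
    _ = ∫⁻ θ, S.indicator ω θ ∂(μHE[m]).comap ((↑) :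
          sphere (0 : EuclideanSpace ℝ (Fin (m + 1))) 1 → EuclideanSpace ℝ (Fin (m + 1))) :=
        (lintegral_subtype_comap isClosed_sphere.measurableSet _).symm
    _ ≤ ∫⁻ θ, S.indicator ω θ ∂σ :=
        lintegral_mono' (comap_euclideanHausdorffMeasure_le_toSphere m) le_rfl
    _ = ENNReal.ofReal (m + α + 1) * ∫⁻ x in ({0}ᶜ : Set (EuclideanSpace ℝ (Fin (m + 1)))), h x := by
        rw [hpolar, ← mul_assoc, ← ENNReal.ofReal_mul hq.le, mul_one_div_cancel hq.ne',
          ENNReal.ofReal_one, one_mul]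
    _ ≤ ENNReal.ofReal (m + α + 1) * ∫⁻ x, h x := by
        gcongr
        exact Measure.restrict_le_self
    _ = ENNReal.ofReal (m + α + 1) * ∫⁻ x in S ∩ ball 0 1, ω x := by
        rw [lintegral_indicator (hS.inter measurableSet_ball)]

/-- A positive homogeneous function `w` of degree `α` with `w ^ (1 / α)` concave if `0 < α` is
log-concave. -/
theorem rpow_mul_rpow_le_of_concaveOn_rpow {E : Type*} [NormedAddCommGroup E] [NormedSpace ℝ E]
    {S : Set E} (hS : Convex ℝ S) (hScone : ∀ x ∈ S, ∀ t : ℝ, 0 < t → t • x ∈ S)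
    {w : E → ℝ} {α : ℝ} (hα : 0 ≤ α) (hwcont : ContinuousOn w (closure S))
    (hwpos : ∀ x ∈ S, 0 < w x) (hhom : ∀ x ∈ S, ∀ t : ℝ, 0 < t → w (t • x) = t ^ α * w x)
    (hconc : 0 < α → ConcaveOn ℝ S fun x => w x ^ (1 / α)) {x y : E} (hx : x ∈ S) (hy : y ∈ S)
    {a b : ℝ} (ha : 0 < a) (hb : 0 < b) (hab : a + b = 1) :
    w x ^ a * w y ^ b ≤ w (a • x + b • y) := by
  have hxy : a • x + b • y ∈ S := hS hx hy ha.le hb.le hab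
  rcases hα.eq_or_lt with rfl | hα
  · have const : ∀ z ∈ S, w z = w 0 := by
      intro z hz
      have hlim : Tendsto (fun t : ℝ => t • z) (𝓝[>] 0) (𝓝 0) := by
        have : Tendsto (fun t : ℝ => t • z) (𝓝 0) (𝓝 ((0 : ℝ) • z)) :=
          (continuous_id.smul continuous_const).tendsto 0
        rw [zero_smul] at this
        exact this.mono_left nhdsWithin_le_nhds
      have hmem : ∀ᶠ t : ℝ in 𝓝[>] 0, t • z ∈ S :=
        eventually_mem_nhdsWithin.mono fun t ht => hScone z hz t ht
      have h0 : (0 : E) ∈ closure S := mem_closure_of_tendsto hlim hmem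
      have h1 : Tendsto (fun t : ℝ => w (t • z)) (𝓝[>] 0) (𝓝 (w 0)) :=
        (hwcont 0 h0).tendsto.comp
          (tendsto_nhdsWithin_iff.2 ⟨hlim, hmem.mono fun t ht => subset_closure ht⟩)
      refine tendsto_nhds_unique (tendsto_const_nhds.congr' ?_) h1
      filter_upwards [self_mem_nhdsWithin] with t ht
      rw [hhom z hz t ht, Real.rpow_zero, one_mul]
    rw [const x hx, const y hy, const _ hxy, ← Real.rpow_add (const x hx ▸ hwpos x hx), hab,
      Real.rpow_one]
  · have hwx := hwpos x hx
    have hwy := hwpos y hy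
    have h1 : (w x ^ (1 / α)) ^ a * (w y ^ (1 / α)) ^ b ≤ w (a • x + b • y) ^ (1 / α) :=
      (Real.geom_mean_le_arith_mean2_weighted ha.le hb.le (by positivity) (by positivity) hab).trans
        ((hconc hα).2 hx hy ha.le hb.le hab)
    have h2 := Real.rpow_le_rpow (by positivity) h1 hα.le
    rw [Real.mul_rpow (by positivity) (by positivity)] at h2
    simp only [← Real.rpow_mul hwx.le, ← Real.rpow_mul hwy.le,
      ← Real.rpow_mul (hwpos _ hxy).le] at h2
    field_simp at h2
    simpa using h2

/-- Adding to `Ω` a small multiple of a convex cone's unit ball stays in a collar of `Ω`. -/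
theorem add_smul_inter_ball_subset {E : Type*} [NormedAddCommGroup E] [NormedSpace ℝ E]
    {S Ω : Set E} (hadd : ∀ x ∈ S, ∀ y ∈ S, x + y ∈ S)
    (hScone : ∀ x ∈ S, ∀ t : ℝ, 0 < t → t • x ∈ S) (hΩS : Ω ⊆ S) {ε : ℝ} (hε : 0 < ε) {x y : E}
    (hx : x ∈ Ω) (hy : ε⁻¹ • y ∈ S ∩ ball 0 1) :
    x + y ∈ S ∧ x + y ∈ thickening ε Ω := by
  have hyS : y ∈ S := by simpa [smul_smul, mul_inv_cancel₀ hε.ne'] using hScone _ hy.1 ε hε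
  refine ⟨hadd x (hΩS hx) y hyS, mem_thickening_iff.2 ⟨x, hx, ?_⟩⟩
  have h := hy.2
  rw [mem_ball_zero_iff, norm_smul, norm_inv, Real.norm_of_nonneg hε.le, inv_mul_lt_iff₀ hε,
    mul_one] at h
  simpa [dist_eq_norm] using h

theorem Convex.add_mem_of_cone {E : Type*} [NormedAddCommGroup E] [NormedSpace ℝ E]
    {S : Set E} (hS : Convex ℝ S) (hScone : ∀ x ∈ S, ∀ t : ℝ, 0 < t → t • x ∈ S) {x y : E}
    (hx : x ∈ S) (hy : y ∈ S) : x + y ∈ S := by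
  have h := hScone _ (hS hx hy (a := 2⁻¹) (b := 2⁻¹) (by norm_num) (by norm_num) (by norm_num)) 2
    two_pos
  simpa [smul_smul] using h

/-- A **Minkowski-type inequality**: the first variation of the weighted Brunn–Minkowski inequality
bounds the weighted perimeter from below. -/
theorem IsLipschitzDomain.ofReal_le_setLIntegral_frontier {m : ℕ}
    {S Ω : Set (EuclideanSpace ℝ (Fin (m + 1)))} (hΩ : IsLipschitzDomain Ω) (hSo : IsOpen S)
    (hS : Convex ℝ S) (hScone : ∀ x ∈ S, ∀ t : ℝ, 0 < t → t • x ∈ S) (hΩS : Ω ⊆ S)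
    {W : EuclideanSpace ℝ (Fin (m + 1)) → ℝ≥0} (hW : Continuous W) {α : ℝ} (hα : 0 ≤ α)
    (hhom : ∀ x ∈ S, ∀ t : ℝ, 0 < t → (W (t • x) : ℝ≥0∞) = ENNReal.ofReal (t ^ α) * W x)
    (hlog : ∀ x ∈ S, ∀ y ∈ S, ∀ a b : ℝ, 0 < a → 0 < b → a + b = 1 →
      (W x : ℝ≥0∞) ^ a * (W y : ℝ≥0∞) ^ b ≤ W (a • x + b • y))
    {a b : ℝ} (ha : 0 < a) (hb : 0 < b)
    (hmΩ : ∫⁻ x in Ω, W x = ENNReal.ofReal (a ^ (m + α + 1)))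
    (hmB : ∫⁻ x in S ∩ ball 0 1, W x = ENNReal.ofReal (b ^ (m + α + 1))) :
    ENNReal.ofReal ((m + α + 1) * a ^ (m + α) * b) ≤ ∫⁻ y in S ∩ frontier Ω, W y ∂μHE[m] := by
  have hωm : Measurable fun x => (W x : ℝ≥0∞) := hW.measurable.coe_nnreal_ennreal
  have hD : ((m + 1 : ℕ) : ℝ) + α = m + α + 1 := by push_cast; ring
  have hadd : ∀ x ∈ S, ∀ y ∈ S, x + y ∈ S := fun x hx y hy => hS.add_mem_of_cone hScone hx hy
  have collar : ∀ ε : ℝ, 0 < ε → ENNReal.ofReal ((m + α + 1) * a ^ (m + α) * b) ≤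
      (ENNReal.ofReal ε)⁻¹ * ∫⁻ y in outerCollar S Ω ε, W y := by
    intro ε hε
    let B := (fun x : EuclideanSpace ℝ (Fin (m + 1)) => ε⁻¹ • x) ⁻¹' (S ∩ ball 0 1)
    have hBo : IsOpen B := (hSo.inter isOpen_ball).preimage (continuous_const_smul _)
    have hsub : ∀ x ∈ Ω, ∀ y ∈ B, x + y ∈ S ∧ x + y ∈ thickening ε Ω := fun x hx y hy =>
      add_smul_inter_ball_subset hadd hScone hΩS hε hx hy
    have hBS : B ⊆ S := fun y hy => by
      simpa [smul_smul, mul_inv_cancel₀ hε.ne'] using hScone _ hy.1 ε hε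
    have hB : ∫⁻ x in B, W x = ENNReal.ofReal ((ε * b) ^ (((m + 1 : ℕ) : ℝ) + α)) := by
      rw [setLIntegral_smul_of_homogeneous hωm hhom (hSo.inter isOpen_ball).measurableSet
        inter_subset_left hε, hmB, ← ENNReal.ofReal_mul (by positivity), hD,
        Real.mul_rpow hε.le hb.le]
    have hBM := weighted_brunnMinkowski hScone hωm hhom hlog hΩ.1 hBo hΩS hBS
      (by rintro _ ⟨x, hx, y, hy, rfl⟩; exact (hsub x hx y hy).1) ha (mul_pos hε hb)
      (by rw [hmΩ, hD]) hB
    have hbern : a ^ (m + α + 1) + ε * ((m + α + 1) * a ^ (m + α) * b) ≤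
        (a + ε * b) ^ (((m + 1 : ℕ) : ℝ) + α) := by
      have h1 := one_add_mul_self_le_rpow_one_add (s := ε * b / a) (p := m + α + 1)
        (by have : 0 ≤ ε * b / a := by positivity
            linarith) (by linarith [(Nat.cast_nonneg m : (0 : ℝ) ≤ m)])
      have h2 : a + ε * b = a * (1 + ε * b / a) := by field_simp
      rw [hD, h2, Real.mul_rpow ha.le (by positivity)]
      refine le_trans (le_of_eq ?_) (mul_le_mul_of_nonneg_left h1 (by positivity))
      rw [Real.rpow_add_one ha.ne']
      field_simp
    have hle : ENNReal.ofReal (a ^ (m + α + 1)) +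
        ENNReal.ofReal ε * ENNReal.ofReal ((m + α + 1) * a ^ (m + α) * b) ≤
        ENNReal.ofReal (a ^ (m + α + 1)) + ∫⁻ y in outerCollar S Ω ε, W y := by
      rw [← ENNReal.ofReal_mul hε.le, ← ENNReal.ofReal_add (by positivity) (by positivity)]
      refine (ENNReal.ofReal_le_ofReal hbern).trans (hBM.trans ?_)
      rw [← hmΩ]
      refine (lintegral_mono_set ?_).trans (lintegral_union_le _ _ _)
      rintro _ ⟨x, hx, y, hy, rfl⟩
      by_cases h : x + y ∈ Ω
      · exact Or.inl h
      · exact Or.inr ⟨(hsub x hx y hy).1, (hsub x hx y hy).2, h⟩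
    have hle' := (ENNReal.add_le_add_iff_left ENNReal.ofReal_ne_top).1 hle
    rwa [← ENNReal.div_eq_inv_mul, ENNReal.le_div_iff_mul_le (Or.inl (by simpa using hε))
      (Or.inl ENNReal.ofReal_ne_top), mul_comm (ENNReal.ofReal _)]
  refine le_trans ?_ (hΩ.limsup_collar_le hSo hS hΩS hW (ε := fun k : ℕ => 1 / ((k : ℝ) + 1))
    (fun k => by positivity) tendsto_one_div_add_atTop_nhds_zero_nat)
  refine le_trans ?_ (liminf_le_limsup (f := atTop))
  exact le_liminf_of_le (by isBoundedDefault)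
    (Eventually.of_forall fun k : ℕ => collar _ (by positivity))

/-- The weighted volume of a nonempty bounded open set, as a power of a positive number. -/
theorem exists_setLIntegral_eq_ofReal_rpow {n : ℕ} {A : Set (EuclideanSpace ℝ (Fin n))}
    (hA : IsOpen A) (hne : A.Nonempty) (hb : Bornology.IsBounded A)
    {W : EuclideanSpace ℝ (Fin n) → ℝ≥0} (hW : Continuous W) (hpos : ∀ x ∈ A, 0 < W x)
    {p : ℝ} (hp : 0 < p) :
    ∃ a : ℝ, 0 < a ∧ ∫⁻ x in A, W x = ENNReal.ofReal (a ^ p) := by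
  have hfin : ∫⁻ x in A, W x < ∞ := by
    obtain ⟨C, hC⟩ := hb.isCompact_closure.bddAbove_image hW.continuousOn
    calc ∫⁻ x in A, W x ≤ ∫⁻ _ in A, (C : ℝ≥0∞) :=
          setLIntegral_mono measurable_const fun x hx =>
            ENNReal.coe_le_coe.2 (hC ⟨x, subset_closure hx, rfl⟩)
      _ < ∞ := by
          rw [setLIntegral_const]
          exact ENNReal.mul_lt_top ENNReal.coe_lt_top hb.measure_lt_top
  have hpos' : 0 < ∫⁻ x in A, W x := by
    rw [setLIntegral_pos_iff hW.measurable.coe_nnreal_ennreal]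
    have hsub : A ⊆ Function.support (fun x => (W x : ℝ≥0∞)) ∩ A := fun x hx =>
      ⟨by simpa using (hpos x hx).ne', hx⟩
    exact (hA.measure_pos volume hne).trans_le (measure_mono hsub)
  have hr : 0 < (∫⁻ x in A, W x).toReal := ENNReal.toReal_pos hpos'.ne' hfin.ne
  refine ⟨(∫⁻ x in A, W x).toReal ^ p⁻¹, by positivity, ?_⟩
  rw [Real.rpow_inv_rpow hr.le hp.ne', ENNReal.ofReal_toReal hfin.ne]

theorem IsOpen.inter_frontier_inter_ball {E : Type*} [NormedAddCommGroup E] [NormedSpace ℝ E]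
    {S : Set E} (hS : IsOpen S) : S ∩ frontier (S ∩ ball 0 1) = S ∩ sphere (0 : E) 1 := by
  rw [← frontier_ball (0 : E) one_ne_zero, inter_comm S (ball 0 1), inter_comm S, inter_comm S,
    frontier_inter_open_inter hS]

theorem setIntegral_eq_toReal_setLIntegral {X : Type*} [MeasurableSpace X] {μ : Measure X}
    {A : Set X} (hA : MeasurableSet A) {w : X → ℝ} {W : X → ℝ≥0} (hW : Measurable W)
    (h : ∀ x ∈ A, w x = W x) : ∫ x in A, w x ∂μ = (∫⁻ x in A, W x ∂μ).toReal := by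
  rw [setIntegral_congr_fun hA h, integral_eq_lintegral_of_nonneg_ae
    (Eventually.of_forall fun x => (W x).coe_nonneg) hW.coe_nnreal_real.aestronglyMeasurable]
  simp

/-- A continuous function on a closed set that is positive on a dense part of it extends to a
continuous nonnegative function on the whole space. -/
theorem exists_continuous_nnreal_extension {X : Type*} [TopologicalSpace X] [NormalSpace X]
    {S : Set X} {w : X → ℝ} (hw : ContinuousOn w (closure S)) (hpos : ∀ x ∈ S, 0 < w x) :
    ∃ W : X → ℝ≥0, Continuous W ∧ ∀ x ∈ S, w x = W x := by
  obtain ⟨g, hg⟩ := ContinuousMap.exists_restrict_eq isClosed_closure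
    (⟨(closure S).domRestrict w, hw.domRestrict⟩ : C(closure S, ℝ))
  refine ⟨fun x => (g x).toNNReal, continuous_real_toNNReal.comp g.continuous, fun x hx => ?_⟩
  have h : g x = w x := congrArg (fun f : C(closure S, ℝ) => f ⟨x, subset_closure hx⟩) hg
  simp [h, (hpos x hx).le]

theorem IsLipschitzDomain.setLIntegral_frontier_lt_top {m : ℕ}
    {S Ω : Set (EuclideanSpace ℝ (Fin (m + 1)))} (hΩ : IsLipschitzDomain Ω)
    {W : EuclideanSpace ℝ (Fin (m + 1)) → ℝ≥0} (hW : Continuous W) :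
    ∫⁻ x in S ∩ frontier Ω, W x ∂μHE[m] < ∞ := by
  obtain ⟨C, hC⟩ := hΩ.isCompact_frontier.bddAbove_image hW.continuousOn
  calc ∫⁻ x in S ∩ frontier Ω, W x ∂μHE[m] ≤ ∫⁻ _ in S ∩ frontier Ω, (C : ℝ≥0∞) ∂μHE[m] :=
        setLIntegral_mono measurable_const fun x hx => ENNReal.coe_le_coe.2 (hC ⟨x, hx.2, rfl⟩)
    _ < ∞ := by
        rw [setLIntegral_const]
        exact ENNReal.mul_lt_top ENNReal.coe_lt_top
          ((measure_mono inter_subset_right).trans_lt hΩ.euclideanHausdorffMeasure_frontier_lt_top)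

end

/-- **Weighted isoperimetric inequality in convex cones (Cabré, Ros-Oton, Serra).**
Let `Σ` be an open convex cone in `ℝⁿ` and `w` a continuous weight on `closure Σ`,
positive and `C^{1,γ}` in `Σ`, homogeneous of degree `α ≥ 0`, with `w^{1/α}` concave
in case `α > 0`. Then, with `D = n + α`, for every bounded Lipschitz domain `Ω ⊆ Σ`,
`P_Σ(Ω) / m(Ω)^{(D-1)/D} ≥ P_Σ(Σ ∩ B₁) / m(Σ ∩ B₁)^{(D-1)/D}`, where the weighted
perimeter inside the cone is measured with the `(n-1)`-dimensional Hausdorff measure. -/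
theorem weighted_isoperimetric_inequality_in_convex_cones
    (n : ℕ) (hn : 1 ≤ n)
    (S : Set (EuclideanSpace ℝ (Fin n)))
    (hSopen : IsOpen S) (hSconv : Convex ℝ S)
    (hScone : ∀ x ∈ S, ∀ t : ℝ, 0 < t → t • x ∈ S)
    (w : EuclideanSpace ℝ (Fin n) → ℝ) (α : ℝ) (hα : 0 ≤ α)
    (hwcont : ContinuousOn w (closure S))
    (hwpos : ∀ x ∈ S, 0 < w x)
    (γ : ℝ≥0) (hγ0 : 0 < γ) (hγ1 : γ < 1)
    (hwC1 : ContDiffOn ℝ 1 w S)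
    (hwHolder : ∀ x ∈ S, ∃ U ∈ nhds x, ∃ C : ℝ≥0,
      HolderOnWith C γ (fderiv ℝ w) (U ∩ S))
    (hhom : ∀ x ∈ S, ∀ t : ℝ, 0 < t → w (t • x) = t ^ α * w x)
    (hconc : 0 < α → ConcaveOn ℝ S (fun x => w x ^ (1 / α)))
    (Ω : Set (EuclideanSpace ℝ (Fin n))) (hΩ : IsLipschitzDomain Ω) (hΩS : Ω ⊆ S) :
    (∫ x in S ∩ frontier (S ∩ ball (0 : EuclideanSpace ℝ (Fin n)) 1), w x
        ∂(μH[(n : ℝ) - 1])) /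
      (∫ x in S ∩ ball (0 : EuclideanSpace ℝ (Fin n)) 1, w x) ^
        (((n : ℝ) + α - 1) / ((n : ℝ) + α)) ≤
    (∫ x in S ∩ frontier Ω, w x ∂(μH[(n : ℝ) - 1])) /
      (∫ x in Ω, w x) ^ (((n : ℝ) + α - 1) / ((n : ℝ) + α)) := by
  obtain ⟨m, rfl⟩ := Nat.exists_eq_add_of_le' hn
  obtain ⟨W, hW, hwW⟩ := exists_continuous_nnreal_extension hwcont hwpos
  have hofReal : ∀ x ∈ S, (W x : ℝ≥0∞) = ENNReal.ofReal (w x) := fun x hx => by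
    rw [hwW x hx, ENNReal.ofReal_coe_nnreal]
  have hWpos : ∀ x ∈ S, 0 < W x := fun x hx => by exact_mod_cast hwW x hx ▸ hwpos x hx
  have hωhom : ∀ x ∈ S, ∀ t : ℝ, 0 < t →
      (W (t • x) : ℝ≥0∞) = ENNReal.ofReal (t ^ α) * W x := fun x hx t ht => by
    rw [hofReal _ (hScone x hx t ht), hofReal x hx, hhom x hx t ht,
      ENNReal.ofReal_mul (by positivity)]
  have hωlog : ∀ x ∈ S, ∀ y ∈ S, ∀ a b : ℝ, 0 < a → 0 < b → a + b = 1 →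
      (W x : ℝ≥0∞) ^ a * (W y : ℝ≥0∞) ^ b ≤ W (a • x + b • y) := by
    intro x hx y hy a b ha hb hab
    rw [hofReal x hx, hofReal y hy, hofReal _ (hSconv hx hy ha.le hb.le hab),
      ENNReal.ofReal_rpow_of_pos (hwpos x hx), ENNReal.ofReal_rpow_of_pos (hwpos y hy),
      ← ENNReal.ofReal_mul (Real.rpow_nonneg (hwpos x hx).le _)]
    exact ENNReal.ofReal_le_ofReal (rpow_mul_rpow_le_of_concaveOn_rpow hSconv hScone hα hwcont
      hwpos hhom hconc hx hy ha hb hab)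
  have hD : 0 < (m : ℝ) + α + 1 := by positivity
  have hΩne : Ω.Nonempty := hΩ.2.1.nonempty
  have hBne : (S ∩ ball (0 : EuclideanSpace ℝ (Fin (m + 1))) 1).Nonempty := by
    obtain ⟨x, hx⟩ := hΩne
    refine ⟨(1 + ‖x‖)⁻¹ • x, hScone x (hΩS hx) _ (by positivity), ?_⟩
    rw [mem_ball_zero_iff, norm_smul, norm_inv, Real.norm_of_nonneg (by positivity),
      inv_mul_lt_iff₀ (by positivity)]
    linarith
  have hSB : S ∩ ball (0 : EuclideanSpace ℝ (Fin (m + 1))) 1 ⊆ S := inter_subset_left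
  obtain ⟨a, ha, hmΩ⟩ := exists_setLIntegral_eq_ofReal_rpow hΩ.1 hΩne hΩ.2.2.1 hW
    (fun x hx => hWpos x (hΩS hx)) hD
  obtain ⟨b, hb, hmB⟩ := exists_setLIntegral_eq_ofReal_rpow (hSopen.inter isOpen_ball) hBne
    (isBounded_ball.subset inter_subset_right) hW (fun x hx => hWpos x (hSB hx)) hD
  have hlower := hΩ.ofReal_le_setLIntegral_frontier hSopen hSconv hScone hΩS hW hα hωhom hωlog
    ha hb hmΩ hmB
  have hupper := setLIntegral_sphere_le hSopen.measurableSet hScone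
    hW.measurable.coe_nnreal_ennreal hα hωhom
  rw [hmB, ← ENNReal.ofReal_mul hD.le] at hupper
  have hdim : ((m + 1 : ℕ) : ℝ) - 1 = (m : ℕ) := by push_cast; ring
  have hexp : (((m + 1 : ℕ) : ℝ) + α - 1) / (((m + 1 : ℕ) : ℝ) + α) =
      (m + α) * (m + α + 1)⁻¹ := by
    rw [div_eq_mul_inv]; push_cast; congr 2 <;> ring
  obtain ⟨c, hc, hcμ⟩ : ∃ c : ℝ≥0, 0 < c ∧
      (μHE[m] : Measure (EuclideanSpace ℝ (Fin (m + 1)))) = c • μH[(m : ℕ)] :=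
    ⟨_, pos_iff_ne_zero.2 (Measure.addHaarScalarFactor_volume_hausdorffMeasure_ne_zero m),
      Measure.euclideanHausdorffMeasure_def m⟩
  have hscale : ∀ A : Set (EuclideanSpace ℝ (Fin (m + 1))), MeasurableSet A → A ⊆ S →
      (c : ℝ) * ∫ x in A, w x ∂(μH[(m : ℕ)]) = (∫⁻ x in A, W x ∂μHE[m]).toReal := by
    intro A hA hAS
    rw [← setIntegral_eq_toReal_setLIntegral hA hW.measurable fun x hx => hwW x (hAS hx), hcμ,
      Measure.restrict_smul, integral_smul_nnreal_measure, NNReal.smul_def, smul_eq_mul]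
  have hvol : ∀ A : Set (EuclideanSpace ℝ (Fin (m + 1))), MeasurableSet A → A ⊆ S →
      ∀ r : ℝ, 0 < r → ∫⁻ x in A, W x = ENNReal.ofReal (r ^ (m + α + 1)) →
      (∫ x in A, w x) ^ ((m + α) * (m + α + 1)⁻¹) = r ^ (m + α) := by
    intro A hA hAS r hr h
    rw [setIntegral_eq_toReal_setLIntegral hA hW.measurable fun x hx => hwW x (hAS hx), h,
      ENNReal.toReal_ofReal (by positivity), ← Real.rpow_mul hr.le]
    congr 1
    field_simp
  rw [hSopen.inter_frontier_inter_ball, hdim, hexp,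
    hvol _ (hSopen.inter isOpen_ball).measurableSet hSB b hb hmB,
    hvol Ω hΩ.1.measurableSet hΩS a ha hmΩ]
  have hP := ENNReal.toReal_mono ENNReal.ofReal_ne_top hupper
  have hQ := ENNReal.toReal_mono (hΩ.setLIntegral_frontier_lt_top (S := S) hW).ne hlower
  rw [← hscale _ (hSopen.measurableSet.inter isClosed_sphere.measurableSet) inter_subset_left,
    ENNReal.toReal_ofReal (by positivity)] at hP
  rw [← hscale _ (hSopen.measurableSet.inter isClosed_frontier.measurableSet) inter_subset_left,
    ENNReal.toReal_ofReal (by positivity)] at hQ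
  have hc' : (0 : ℝ) < c := hc
  refine le_trans (b := (m + α + 1) * b / c) ?_ ?_
  · rw [div_le_div_iff₀ (by positivity) hc', mul_comm, mul_assoc, mul_comm b,
      ← Real.rpow_add_one hb.ne']
    exact hP
  · rw [div_le_div_iff₀ hc' (by positivity), mul_comm (integral _ _)]
    exact le_trans (le_of_eq (by ring)) hQ

end
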